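/- In M̄(1,0,0) (the W_3 vacuum vertex operator algebra at central charge 1), there exists a nonzero primary vector u^{(6)} of weight 6 of the form u^{(6)} = a_1 W_{−3}w + a_5 v with a_1 ≠ 0 and v in the Virasoro vacuum submodule L(1,0) generated by 1; consequently W_{−3}w ∈ L(1,0) ⊕ L(1,6), where L(1,6) denotes the L(1,0)-submodule generated by u^{(6)}, which is an irreducible highest weight module for the Virasoro algebra of highest weight 6. -/

import Mathlib

open scoped BigOperators

/-- A representation of the `𝒲₃` algebra at central charge `c` with a
vacuum-like vector `one` annihilated by all nonnegative modes together with
`L₋₁`, `W₋₁` and `W₋₂`.  The term `Λ` in the `[W,W]` relation is written as a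
truncated (eventually constant) sum, which is meaningful thanks to the lower
truncation axiom. -/
structure W3Rep (c : ℂ) where
  carrier : Type
  [addCommGroupCarrier : AddCommGroup carrier]
  [moduleCarrier : Module ℂ carrier]
  L : ℤ → carrier →ₗ[ℂ] carrier
  W : ℤ → carrier →ₗ[ℂ] carrier
  one : carrier
  L_one : ∀ n : ℤ, -1 ≤ n → L n one = 0
  W_one : ∀ n : ℤ, -2 ≤ n → W n one = 0
  truncation : ∀ v : carrier, ∃ N : ℤ, ∀ n : ℤ, N ≤ n → L n v = 0 ∧ W n v = 0
  relLL : ∀ (m n : ℤ) (v : carrier),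
    L m (L n v) - L n (L m v)
      = ((m - n : ℤ) : ℂ) • L (m + n) v
        + (if m + n = 0 then ((m ^ 3 - m : ℤ) : ℂ) / 12 * c else 0) • v
  relLW : ∀ (m n : ℤ) (v : carrier),
    L m (W n v) - W n (L m v) = ((2 * m - n : ℤ) : ℂ) • W (m + n) v
  relWW : ∀ (m n : ℤ) (v : carrier), ∃ N : ℕ, ∀ K : ℕ, N ≤ K →
    W m (W n v) - W n (W m v)
      = (((m - n : ℤ) : ℂ) *
            ((1 / 15 : ℂ) * (((m + n + 2) * (m + n + 3) : ℤ) : ℂ)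
              - (1 / 6 : ℂ) * (((m + 2) * (n + 2) : ℤ) : ℂ))) • L (m + n) v
        + ((16 / (22 + 5 * c)) * ((m - n : ℤ) : ℂ)) •
            ((∑ j ∈ Finset.range K, L (-((j : ℤ) + 2)) (L (m + n + ((j : ℤ) + 2)) v))
              + (∑ j ∈ Finset.range K, L (m + n - ((j : ℤ) - 1)) (L ((j : ℤ) - 1) v))
              - ((3 / 10 : ℂ) * (((m + n + 2) * (m + n + 3) : ℤ) : ℂ)) • L (m + n) v)
        + (if m + n = 0 then ((m * (m ^ 2 - 1) * (m ^ 2 - 4) : ℤ) : ℂ) / 360 * c else 0) • v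

attribute [instance] W3Rep.addCommGroupCarrier W3Rep.moduleCarrier

namespace W3Rep

variable {c : ℂ} (M : W3Rep c)

/-- The generator `w = W₋₃𝟙`. -/
def w : M.carrier := M.W (-3) M.one

/-- A subspace stable under all the operators `L n` and `W n`. -/
def Invariant (N : Submodule ℂ M.carrier) : Prop :=
  ∀ n : ℤ, ∀ x ∈ N, M.L n x ∈ N ∧ M.W n x ∈ N

/-- A subspace stable under all the Virasoro operators `L n`. -/
def VirInvariant (N : Submodule ℂ M.carrier) : Prop :=
  ∀ n : ℤ, ∀ x ∈ N, M.L n x ∈ N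

/-- The module for the Virasoro algebra generated by a vector. -/
def VirGen (v : M.carrier) : Submodule ℂ M.carrier :=
  sInf {N : Submodule ℂ M.carrier | v ∈ N ∧ M.VirInvariant N}

lemma mem_VirGen_self (v : M.carrier) : v ∈ M.VirGen v :=
  Submodule.mem_sInf.2 fun _ hN => hN.1

/-- The weight-`r` subspace: the `L₀`-eigenspace with eigenvalue `r`. -/
def wt (r : ℂ) : Submodule ℂ M.carrier :=
  LinearMap.ker (M.L 0 - r • (LinearMap.id : M.carrier →ₗ[ℂ] M.carrier))

/-- A primary vector: a nonzero vector killed by all `L n`, `n ≥ 1`. -/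
def IsPrimary (v : M.carrier) : Prop :=
  v ≠ 0 ∧ ∀ n : ℤ, 1 ≤ n → M.L n v = 0

/-- Irreducibility of a `𝒲₃`-representation. -/
def Irreducible : Prop :=
  (⊥ : Submodule ℂ M.carrier) ≠ ⊤ ∧
    ∀ N : Submodule ℂ M.carrier, M.Invariant N → N = ⊥ ∨ N = ⊤

end W3Rep

/-- A homomorphism of `𝒲₃`-representations sending vacuum to vacuum. -/
structure W3Hom {c : ℂ} (M N : W3Rep c) where
  f : M.carrier →ₗ[ℂ] N.carrier
  map_one : f M.one = N.one
  map_L : ∀ (n : ℤ) (v : M.carrier), f (M.L n v) = N.L n (f v)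
  map_W : ∀ (n : ℤ) (v : M.carrier), f (M.W n v) = N.W n (f v)

/-- The `𝒲₃` vacuum vertex operator algebra `M̄(c,0,0)`: the universal
`𝒲₃`-representation generated by a vacuum vector annihilated by all
nonnegative modes together with `L₋₁`, `W₋₁`, `W₋₂`. -/
structure W3Vacuum (c : ℂ) extends W3Rep c where
  one_ne : one ≠ 0
  universal : ∀ M : W3Rep c, ∃ φ : W3Hom toW3Rep M, ∀ ψ : W3Hom toW3Rep M, ψ = φ

namespace Virasoro

section Words

variable {V : Type*} [AddCommGroup V] [Module ℂ V]

/-- The commutation relations of the Virasoro algebra at central charge `1`. -/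
def Relations (L : ℤ → V →ₗ[ℂ] V) : Prop :=
  ∀ (m n : ℤ) (v : V),
    L m (L n v) - L n (L m v)
      = ((m - n : ℤ) : ℂ) • L (m + n) v
        + (if m + n = 0 then ((m ^ 3 - m : ℤ) : ℂ) / 12 * 1 else 0) • v

/-- A vector of weight `h` annihilated by all `L n` with `n ≥ 1`. -/
def HighestWeight (L : ℤ → V →ₗ[ℂ] V) (h : ℂ) (v : V) : Prop :=
  L 0 v = h • v ∧ ∀ n : ℤ, 1 ≤ n → L n v = 0

/-- The word `L₋₍ₖ₁₊₁₎ L₋₍ₖ₂₊₁₎ ⋯ v` for a list `[k₁, k₂, …]`. -/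
def word (L : ℤ → V →ₗ[ℂ] V) (v : V) (l : List ℕ) : V :=
  l.foldr (fun k x => L (-((k : ℤ) + 1)) x) v

@[simp] lemma word_nil (L : ℤ → V →ₗ[ℂ] V) (v : V) : word L v [] = v := rfl

@[simp] lemma word_cons (L : ℤ → V →ₗ[ℂ] V) (v : V) (k : ℕ) (l : List ℕ) :
    word L v (k :: l) = L (-((k : ℤ) + 1)) (word L v l) := rfl

variable {L : ℤ → V →ₗ[ℂ] V} {h : ℂ} {v : V}

lemma map_word_mem_span (hL : Relations L) (hv : HighestWeight L h v) (l : List ℕ) :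
    ∀ n : ℤ, L n (word L v l) ∈ Submodule.span ℂ (Set.range (word L v)) := by
  have letter : ∀ (k : ℕ), ∀ x ∈ Submodule.span ℂ (Set.range (word L v)),
      L (-((k : ℤ) + 1)) x ∈ Submodule.span ℂ (Set.range (word L v)) := by
    intro k x hx
    induction hx using Submodule.span_induction with
    | mem x hx =>
      obtain ⟨l, rfl⟩ := hx
      exact Submodule.subset_span ⟨k :: l, rfl⟩
    | zero => simp
    | add x y _ _ hx hy => rw [map_add]; exact add_mem hx hy
    | smul a x _ hx => rw [map_smul]; exact Submodule.smul_mem _ _ hx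
  induction l with
  | nil =>
    intro n
    rcases lt_trichotomy n 0 with hn | rfl | hn
    · refine Submodule.subset_span ⟨[(-n - 1).toNat], ?_⟩
      have : -(((-n - 1).toNat : ℤ) + 1) = n := by omega
      simp only [word_cons, word_nil, this]
    · rw [word_nil, hv.1]
      exact Submodule.smul_mem _ _ (Submodule.subset_span ⟨[], rfl⟩)
    · rw [word_nil, hv.2 n (by omega)]
      exact zero_mem _
  | cons k l ih =>
    intro n
    rw [word_cons, sub_eq_iff_eq_add.1 (hL n (-((k : ℤ) + 1)) (word L v l))]
    exact add_mem (add_mem (Submodule.smul_mem _ _ (ih _))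
      (Submodule.smul_mem _ _ (Submodule.subset_span ⟨l, rfl⟩))) (letter _ _ (ih n))

lemma map_mem_span_word (hL : Relations L) (hv : HighestWeight L h v) (n : ℤ) {x : V}
    (hx : x ∈ Submodule.span ℂ (Set.range (word L v))) :
    L n x ∈ Submodule.span ℂ (Set.range (word L v)) := by
  induction hx using Submodule.span_induction with
  | mem x hx =>
    obtain ⟨l, rfl⟩ := hx
    exact map_word_mem_span hL hv l n
  | zero => simp
  | add x y _ _ hx hy => rw [map_add]; exact add_mem hx hy
  | smul a x _ hx => rw [map_smul]; exact Submodule.smul_mem _ _ hx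

lemma word_mem (N : Submodule ℂ V) (hN : ∀ n : ℤ, ∀ x ∈ N, L n x ∈ N) (hv : v ∈ N)
    (l : List ℕ) : word L v l ∈ N := by
  induction l with
  | nil => exact hv
  | cons k l ih => exact hN _ _ ih

/-- Permuting the letters of a word changes it by shorter words only. -/
lemma word_sub_word_mem_of_perm (hL : Relations L) {l l' : List ℕ} (hp : l.Perm l') :
    word L v l - word L v l' ∈
      Submodule.span ℂ (word L v '' {l'' | l''.length < l.length}) := by
  induction hp with
  | nil => simp
  | cons k hp ih =>
    rename_i l₁ l₂
    rw [word_cons, word_cons, ← map_sub]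
    generalize word L v l₁ - word L v l₂ = y at ih
    induction ih using Submodule.span_induction with
    | mem x hx =>
      obtain ⟨l, hl, rfl⟩ := hx
      exact Submodule.subset_span ⟨k :: l, by simpa using hl, rfl⟩
    | zero => simp
    | add x y _ _ hx hy => rw [map_add]; exact add_mem hx hy
    | smul a x _ hx => rw [map_smul]; exact Submodule.smul_mem _ _ hx
  | swap a b l =>
    rw [word_cons, word_cons, word_cons, word_cons, hL, if_neg (by omega), zero_smul, add_zero]
    refine Submodule.smul_mem _ _ (Submodule.subset_span ⟨(a + b + 1) :: l, by simp, ?_⟩)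
    rw [word_cons]
    congr 2
    push_cast
    ring
  | trans hp₁ hp₂ ih₁ ih₂ =>
    rw [← hp₁.length_eq] at ih₂
    simpa using add_mem ih₁ ih₂

/-- The linear map sending a monomial to the corresponding word applied to `v`. -/
noncomputable def wordMap (L : ℤ → V →ₗ[ℂ] V) (v : V) : MvPolynomial ℕ ℂ →ₗ[ℂ] V :=
  (MvPolynomial.basisMonomials ℕ ℂ).constr ℂ
    (fun m => word L v (Finsupp.toMultiset m).toList)

lemma wordMap_monomial (L : ℤ → V →ₗ[ℂ] V) (v : V) (m : ℕ →₀ ℕ) :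
    wordMap L v (MvPolynomial.monomial m 1) = word L v (Finsupp.toMultiset m).toList := by
  have := (MvPolynomial.basisMonomials ℕ ℂ).constr_basis ℂ
    (fun m => word L v (Finsupp.toMultiset m).toList) m
  rwa [MvPolynomial.coe_basisMonomials] at this

lemma word_mem_range_wordMap (hL : Relations L) (l : List ℕ) :
    word L v l ∈ LinearMap.range (wordMap L v) := by
  induction hn : l.length using Nat.strong_induction_on generalizing l with
  | _ n ih =>
    subst hn
    have hp : l.Perm (Multiset.toList (l : Multiset ℕ)) :=
      Multiset.coe_eq_coe.1 (Multiset.coe_toList _).symm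
    have h1 : word L v (Multiset.toList (l : Multiset ℕ)) ∈ LinearMap.range (wordMap L v) :=
      ⟨MvPolynomial.monomial (Multiset.toFinsupp (l : Multiset ℕ)) 1, by
        rw [wordMap_monomial, Multiset.toFinsupp_toMultiset]⟩
    have h2 := word_sub_word_mem_of_perm (v := v) hL hp
    have h3 : Submodule.span ℂ (word L v '' {l'' | l''.length < l.length}) ≤
        LinearMap.range (wordMap L v) := by
      rw [Submodule.span_le]
      rintro _ ⟨l'', hl'', rfl⟩
      exact ih _ hl'' l'' rfl
    simpa using add_mem (h3 h2) h1

lemma span_word_eq_range (hL : Relations L) :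
    Submodule.span ℂ (Set.range (word L v)) = LinearMap.range (wordMap L v) := by
  apply le_antisymm
  · rw [Submodule.span_le]
    rintro _ ⟨l, rfl⟩
    exact word_mem_range_wordMap hL l
  · rw [wordMap, Module.Basis.constr_range]
    apply Submodule.span_mono
    rintro _ ⟨m, rfl⟩
    exact ⟨_, rfl⟩

lemma map_mem_range_wordMap (hL : Relations L) (hv : HighestWeight L h v) (n : ℤ) {x : V}
    (hx : x ∈ LinearMap.range (wordMap L v)) : L n x ∈ LinearMap.range (wordMap L v) := by
  rw [← span_word_eq_range hL] at hx ⊢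
  exact map_mem_span_word hL hv n hx

lemma self_mem_range_wordMap (hL : Relations L) : v ∈ LinearMap.range (wordMap L v) :=
  word_mem_range_wordMap hL []

end Words

open MvPolynomial

/-- The Fock space of the Heisenberg algebra; `X i` is the creation operator of level `i + 1`. -/
abbrev Fock := MvPolynomial ℕ ℂ

section Commutator

variable {V : Type*} [AddCommGroup V] [Module ℂ V]

/-- The commutator of two endomorphisms. -/
def brk (a b : Module.End ℂ V) : Module.End ℂ V := a * b - b * a

variable (a b c : Module.End ℂ V)

lemma brk_apply (x : V) : brk a b x = a (b x) - b (a x) := rfl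

lemma brk_skew : brk a b = -brk b a := by simp [brk]

lemma brk_smul_left (r : ℂ) : brk (r • a) b = r • brk a b := by
  simp [brk, smul_sub]

lemma brk_smul_right (r : ℂ) : brk a (r • b) = r • brk a b := by
  simp [brk, smul_sub]

lemma brk_add_left : brk (a + b) c = brk a c + brk b c := by
  simp only [brk]; noncomm_ring

lemma brk_sub_left : brk (a - b) c = brk a c - brk b c := by
  simp only [brk]; noncomm_ring

lemma brk_mul_left : brk (a * b) c = a * brk b c + brk a c * b := by
  simp only [brk]; noncomm_ring

lemma brk_sum_left {ι : Type*} (s : Finset ι) (f : ι → Module.End ℂ V) :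
    brk (∑ i ∈ s, f i) c = ∑ i ∈ s, brk (f i) c := by
  simp only [brk, Finset.sum_mul, Finset.mul_sum, Finset.sum_sub_distrib]

lemma brk_jacobi : brk (brk a b) c = brk a (brk b c) - brk b (brk a c) := by
  simp only [brk]; noncomm_ring

@[simp] lemma brk_smul_one_left (r : ℂ) : brk (r • 1) a = 0 := by simp [brk]

@[simp] lemma brk_smul_one_right (r : ℂ) : brk a (r • 1) = 0 := by simp [brk]

end Commutator

/-- Heisenberg modes `bₙ` of momentum `μ`, normalised by `[bₘ, bₙ] = 2 m δ`. -/
noncomputable def heis (μ : ℂ) : ℤ → Module.End ℂ Fock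
  | Int.ofNat 0 => μ • 1
  | Int.ofNat (k + 1) => (2 * ((k : ℂ) + 1)) • (pderiv k : Derivation ℂ Fock Fock).toLinearMap
  | Int.negSucc k => LinearMap.mulLeft ℂ (X k)

/-- The first order part of the Virasoro mode `Lₙ`. -/
noncomputable def der (n : ℤ) : Derivation ℂ Fock Fock :=
  mkDerivation ℂ fun j : ℕ => if n ≤ j then ((j : ℂ) + 1) • X (j - n).toNat else 0

/-- The part of the Virasoro mode `Lₙ` quadratic in creation or annihilation operators. -/
noncomputable def quad (μ : ℂ) (n : ℤ) : Module.End ℂ Fock :=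
  (1 / 4 : ℂ) • ∑ i ∈ Finset.Ioo 0 n ∪ Finset.Ioo n 0, heis μ i * heis μ (n - i)

/-- The Virasoro modes acting on the Fock space, with central charge `1`. -/
noncomputable def vir (μ : ℂ) (n : ℤ) : Module.End ℂ Fock :=
  (der n).toLinearMap + quad μ n + if n = 0 then (μ ^ 2 / 4) • 1 else (μ / 2) • heis μ n

variable {μ : ℂ}

lemma heis_zero : heis μ 0 = μ • 1 := rfl

lemma heis_natCast_add_one (k : ℕ) :
    heis μ ((k : ℤ) + 1) =
      (2 * ((k : ℂ) + 1)) • (pderiv k : Derivation ℂ Fock Fock).toLinearMap := rfl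

lemma heis_neg_natCast_add_one (k : ℕ) :
    heis μ (-((k : ℤ) + 1)) = LinearMap.mulLeft ℂ (X k) := by
  rw [← Int.negSucc_eq]; rfl

lemma brk_derivation_mulLeft (D : Derivation ℂ Fock Fock) (f : Fock) :
    brk (D.toLinearMap) (LinearMap.mulLeft ℂ f) = LinearMap.mulLeft ℂ (D f) := by
  refine LinearMap.ext fun g => ?_
  simp [brk_apply, Derivation.leibniz, mul_comm]

lemma coe_lie_derivation (D E : Derivation ℂ Fock Fock) :
    (⁅D, E⁆ : Derivation ℂ Fock Fock).toLinearMap = brk D.toLinearMap E.toLinearMap := rfl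

lemma int_cases (P : ℤ → Prop) (h0 : P 0) (hp : ∀ k : ℕ, P ((k : ℤ) + 1))
    (hn : ∀ k : ℕ, P (-((k : ℤ) + 1))) (n : ℤ) : P n := by
  rcases lt_trichotomy n 0 with h | h | h
  · have := hn (-n - 1).toNat
    rwa [show -(((-n - 1).toNat : ℤ) + 1) = n by omega] at this
  · exact h ▸ h0
  · have := hp (n - 1).toNat
    rwa [show ((n - 1).toNat : ℤ) + 1 = n by omega] at this

lemma brk_derivations_eq_zero {D E : Derivation ℂ Fock Fock}
    (h : ∀ i, D (E (X i)) = E (D (X i))) : brk (D.toLinearMap) (E.toLinearMap) = 0 := by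
  rw [← coe_lie_derivation, show ⁅D, E⁆ = 0 from
    derivation_ext fun i => by simp [Derivation.commutator_apply, h], Derivation.coe_zero_linearMap]

lemma brk_heis_heis (m n : ℤ) :
    brk (heis μ m) (heis μ n) = if m + n = 0 then ((2 * m : ℤ) : ℂ) • 1 else 0 := by
  induction m using int_cases with
  | h0 =>
    rw [heis_zero]
    simp
  | hp i =>
    induction n using int_cases with
    | h0 =>
      rw [heis_zero, if_neg (by omega)]
      simp
    | hp j =>
      rw [heis_natCast_add_one, heis_natCast_add_one, if_neg (by omega), brk_smul_left, brk_smul_right,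
        brk_derivations_eq_zero, smul_zero, smul_zero]
      intro l
      by_cases h1 : l = i <;> by_cases h2 : l = j <;> simp [pderiv_X, Pi.single_apply, h1, h2] <;>
        split_ifs <;> simp
    | hn j =>
      rw [heis_natCast_add_one, heis_neg_natCast_add_one, brk_smul_left, brk_derivation_mulLeft,
        pderiv_X, Pi.single_apply]
      by_cases h : i = j
      · subst h
        rw [if_pos rfl, if_pos (by omega), LinearMap.mulLeft_one]
        push_cast
        rfl
      · rw [if_neg (Ne.symm h), if_neg (by omega), LinearMap.mulLeft_zero_eq_zero, smul_zero]
  | hn i =>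
    induction n using int_cases with
    | h0 =>
      rw [heis_zero, if_neg (by omega)]
      simp
    | hn j =>
      rw [heis_neg_natCast_add_one, heis_neg_natCast_add_one, if_neg (by omega)]
      refine LinearMap.ext fun f => ?_
      simp only [brk_apply, LinearMap.mulLeft_apply, LinearMap.zero_apply]
      ring
    | hp j =>
      rw [heis_natCast_add_one, heis_neg_natCast_add_one, brk_skew, brk_smul_left,
        brk_derivation_mulLeft, pderiv_X, Pi.single_apply]
      by_cases h : i = j
      · subst h
        rw [if_pos rfl, if_pos (by omega), LinearMap.mulLeft_one]
        refine LinearMap.ext fun f => ?_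
        simp only [LinearMap.neg_apply, LinearMap.smul_apply, LinearMap.id_apply,
          Module.End.one_apply]
        push_cast
        module
      · rw [if_neg h, if_neg (by omega), LinearMap.mulLeft_zero_eq_zero, smul_zero, neg_zero]

lemma brk_der_heis (n k : ℤ) :
    brk ((der n).toLinearMap) (heis μ k) =
      if 0 < k * (n + k) then (-(k : ℂ)) • heis μ (n + k) else 0 := by
  induction k using int_cases with
  | h0 =>
    rw [heis_zero]
    simp
  | hn j =>
    rw [heis_neg_natCast_add_one, brk_derivation_mulLeft, der, mkDerivation_X]
    by_cases h : n ≤ j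
    · rw [if_pos h, if_pos (by nlinarith)]
      obtain ⟨i, hi⟩ : ∃ i : ℕ, n + -((j : ℤ) + 1) = -((i : ℤ) + 1) :=
        ⟨(j - n).toNat, by omega⟩
      rw [hi, heis_neg_natCast_add_one, show (j - n).toNat = i by omega]
      refine LinearMap.ext fun f => ?_
      simp
    · rw [if_neg h, if_neg (by nlinarith), LinearMap.mulLeft_zero_eq_zero]
  | hp j =>
    rw [heis_natCast_add_one, brk_smul_right, brk_skew]
    by_cases h : 0 ≤ n + j
    · obtain ⟨i, hi⟩ : ∃ i : ℕ, n + j = i := ⟨(n + j).toNat, by omega⟩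
      rw [if_pos (by nlinarith), show n + ((j : ℤ) + 1) = (i : ℤ) + 1 by omega,
        heis_natCast_add_one, ← coe_lie_derivation,
        show ⁅pderiv j, der n⁆ = ((i : ℂ) + 1) • pderiv i from ?_]
      · refine LinearMap.ext fun f => ?_
        simp only [Derivation.coe_smul_linearMap, LinearMap.neg_apply, LinearMap.smul_apply]
        push_cast
        module
      · refine derivation_ext fun l => ?_
        rw [Derivation.commutator_apply, der, mkDerivation_X, pderiv_X, Derivation.smul_apply,
          pderiv_X, Pi.single_apply, Pi.single_apply]
        have h0 : (mkDerivation ℂ fun j : ℕ => if n ≤ j then ((j : ℂ) + 1) • X (j - n).toNat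
            else (0 : Fock)) (if l = j then 1 else 0) = 0 := by
          split_ifs <;> simp
        rw [h0, sub_zero]
        by_cases hl : n ≤ l
        · rw [if_pos hl, Derivation.map_smul, pderiv_X, Pi.single_apply]
          by_cases hli : l = i
          · subst hli
            rw [if_pos (by omega), if_pos rfl]
          · rw [if_neg (by omega), if_neg hli, smul_zero, smul_zero]
        · rw [if_neg hl, map_zero, if_neg (by omega), smul_zero]
    · rw [if_neg (by nlinarith), brk_derivations_eq_zero, neg_zero, smul_zero]
      intro l
      rw [der, mkDerivation_X, pderiv_X, Pi.single_apply]
      have h0 : (mkDerivation ℂ fun j : ℕ => if n ≤ j then ((j : ℂ) + 1) • X (j - n).toNat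
          else (0 : Fock)) (if l = j then 1 else 0) = 0 := by
        split_ifs <;> simp
      rw [h0]
      by_cases hl : n ≤ l
      · rw [if_pos hl, Derivation.map_smul, pderiv_X, Pi.single_apply, if_neg (by omega),
          smul_zero]
      · rw [if_neg hl, map_zero]

lemma brk_quad_heis (n k : ℤ) :
    brk (quad μ n) (heis μ k) =
      if -k ∈ Finset.Ioo 0 n ∪ Finset.Ioo n 0 then (-(k : ℂ)) • heis μ (n + k) else 0 := by
  rw [quad, brk_smul_left, brk_sum_left]
  simp_rw [brk_mul_left, brk_heis_heis]
  rw [Finset.sum_add_distrib]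
  have h1 : ∀ i : ℤ, (heis μ i * if n - i + k = 0 then ((2 * (n - i) : ℤ) : ℂ) • 1 else 0) =
      if i = n + k then (-2 * (k : ℂ)) • heis μ (n + k) else 0 := by
    intro i
    by_cases h : i = n + k
    · subst h
      rw [if_pos (by ring), if_pos rfl, mul_smul_comm, mul_one]
      congr 1
      push_cast
      ring
    · rw [if_neg (by omega), if_neg h, mul_zero]
  have h2 : ∀ i : ℤ, ((if i + k = 0 then ((2 * i : ℤ) : ℂ) • (1 : Module.End ℂ Fock) else 0) *
      heis μ (n - i)) = if i = -k then (-2 * (k : ℂ)) • heis μ (n + k) else 0 := by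
    intro i
    by_cases h : i = -k
    · subst h
      rw [if_pos (by ring), if_pos rfl, smul_mul_assoc, one_mul, sub_neg_eq_add]
      congr 1
      push_cast
      ring
    · rw [if_neg (by omega), if_neg h, zero_mul]
  simp_rw [h1, h2, Finset.sum_ite_eq']
  have h3 : n + k ∈ Finset.Ioo 0 n ∪ Finset.Ioo n 0 ↔ -k ∈ Finset.Ioo 0 n ∪ Finset.Ioo n 0 := by
    simp only [Finset.mem_union, Finset.mem_Ioo]
    omega
  simp_rw [h3]
  split_ifs
  · rw [← add_smul, smul_smul]
    congr 1
    ring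
  · simp

lemma brk_vir_heis (n k : ℤ) : brk (vir μ n) (heis μ k) = (-(k : ℂ)) • heis μ (n + k) := by
  have h3 : brk (if n = 0 then (μ ^ 2 / 4) • (1 : Module.End ℂ Fock) else (μ / 2) • heis μ n)
      (heis μ k) = if n + k = 0 then (-(k : ℂ)) • heis μ (n + k) else 0 := by
    by_cases hn : n = 0
    · rw [if_pos hn]
      split_ifs with h
      · simp [show k = 0 by omega]
      · simp
    · rw [if_neg hn, brk_smul_left, brk_heis_heis]
      split_ifs with h
      · rw [h, heis_zero, smul_smul, smul_smul, show n = -k by omega]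
        congr 1
        push_cast
        ring
      · simp
  rw [vir, brk_add_left, brk_add_left, brk_der_heis, brk_quad_heis, h3]
  simp only [Finset.mem_union, Finset.mem_Ioo]
  have e1 : 0 < k * (n + k) ↔ (0 < k ∧ 0 < n + k) ∨ (k < 0 ∧ n + k < 0) := mul_pos_iff
  simp only [e1]
  rcases eq_or_ne k 0 with rfl | hk
  · simp
  · split_ifs <;> first | omega | simp

lemma eq_C_of_pderiv_eq_zero {f : Fock} (h : ∀ i, pderiv i f = 0) :
    f = C (constantCoeff f) := by
  ext m
  rw [coeff_C]
  split_ifs with hm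
  · rw [← hm]; rfl
  · obtain ⟨i, hi⟩ : ∃ i, m i ≠ 0 := by
      by_contra! hc
      exact hm (Finsupp.ext fun i => (hc i).symm)
    have h1 := congrArg (coeff (m - Finsupp.single i 1)) (h i)
    rw [coeff_pderiv, tsub_add_cancel_of_le (Finsupp.single_le_iff.2 (by omega)), coeff_zero] at h1
    exact (mul_eq_zero.1 h1).resolve_right (Nat.cast_add_one_ne_zero _)

lemma derivation_toLinearMap_apply (D : Derivation ℂ Fock Fock) (f : Fock) :
    D.toLinearMap f = D f := rfl

lemma eq_smul_of_brk_heis_eq_zero {T : Module.End ℂ Fock} (h : ∀ k : ℤ, brk T (heis μ k) = 0)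
    (f : Fock) : T f = constantCoeff (T 1) • f := by
  have comm : ∀ (k : ℤ) (g : Fock), T (heis μ k g) = heis μ k (T g) := fun k g =>
    sub_eq_zero.1 (LinearMap.congr_fun (h k) g)
  have h1 : T 1 = C (constantCoeff (T 1)) := by
    refine eq_C_of_pderiv_eq_zero fun i => ?_
    have := comm ((i : ℤ) + 1) 1
    rw [heis_natCast_add_one, LinearMap.smul_apply, LinearMap.smul_apply,
      derivation_toLinearMap_apply, Derivation.map_one_eq_zero, smul_zero,
      map_zero] at this
    refine (smul_eq_zero.1 this.symm).resolve_left ?_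
    exact mul_ne_zero two_ne_zero (Nat.cast_add_one_ne_zero i)
  induction f using MvPolynomial.induction_on with
  | C a =>
    rw [C_eq_smul_one, map_smul, smul_comm]
    conv_lhs => rw [h1, C_eq_smul_one]
  | add p q hp hq => rw [map_add, hp, hq, smul_add]
  | mul_X p k hp =>
    have := comm (-((k : ℤ) + 1)) p
    rw [heis_neg_natCast_add_one, LinearMap.mulLeft_apply, LinearMap.mulLeft_apply, hp] at this
    rw [mul_comm, this, mul_smul_comm]

lemma sum_Ioo_neg {A : Type*} [AddCommMonoid A] (n : ℕ) (f : ℤ → A) :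
    ∑ i ∈ Finset.Ioo (-((n : ℤ) + 1)) 0, f i = ∑ j ∈ Finset.range n, f (-((j : ℤ) + 1)) := by
  refine Finset.sum_bij' (fun i _ => (-i - 1).toNat) (fun j _ => -((j : ℤ) + 1)) ?_ ?_ ?_ ?_ ?_
  all_goals simp only [Finset.mem_Ioo, Finset.mem_range]
  · intro a _; omega
  · intro a _; omega
  · intro a _; omega
  · intro a _; omega
  · intro a _; congr 1; omega

lemma sum_Ioo_pos {A : Type*} [AddCommMonoid A] (n : ℕ) (f : ℤ → A) :
    ∑ i ∈ Finset.Ioo 0 ((n : ℤ) + 1), f i = ∑ j ∈ Finset.range n, f ((j : ℤ) + 1) := by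
  refine Finset.sum_bij' (fun i _ => (i - 1).toNat) (fun j _ => (j : ℤ) + 1) ?_ ?_ ?_ ?_ ?_
  all_goals simp only [Finset.mem_Ioo, Finset.mem_range]
  · intro a _; omega
  · intro a _; omega
  · intro a _; omega
  · intro a _; omega
  · intro a _; congr 1; omega

lemma quad_zero : quad μ 0 = 0 := by simp [quad]

lemma quad_neg (n : ℕ) : quad μ (-((n : ℤ) + 1)) =
    (1 / 4 : ℂ) • ∑ j ∈ Finset.range n,
      heis μ (-((j : ℤ) + 1)) * heis μ (-((n : ℤ) + 1) - -((j : ℤ) + 1)) := by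
  rw [quad, Finset.Ioo_eq_empty (a := (0 : ℤ)) (by omega), Finset.empty_union, sum_Ioo_neg]

lemma quad_pos (n : ℕ) : quad μ ((n : ℤ) + 1) =
    (1 / 4 : ℂ) • ∑ j ∈ Finset.range n,
      heis μ ((j : ℤ) + 1) * heis μ ((n : ℤ) + 1 - ((j : ℤ) + 1)) := by
  rw [quad, Finset.Ioo_eq_empty (b := (0 : ℤ)) (by omega), Finset.union_empty, sum_Ioo_pos]

lemma heis_pos_one {k : ℤ} (hk : 0 < k) : heis μ k 1 = 0 := by
  obtain ⟨j, rfl⟩ : ∃ j : ℕ, k = (j : ℤ) + 1 := ⟨(k - 1).toNat, by omega⟩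
  rw [heis_natCast_add_one]
  simp

lemma constantCoeff_heis_neg {k : ℤ} (hk : k < 0) (f : Fock) :
    constantCoeff (heis μ k f) = 0 := by
  obtain ⟨j, rfl⟩ : ∃ j : ℕ, k = -((j : ℤ) + 1) := ⟨(-k - 1).toNat, by omega⟩
  rw [heis_neg_natCast_add_one]
  simp

lemma constantCoeff_heis_one (k : ℤ) :
    constantCoeff (heis μ k 1) = if k = 0 then μ else 0 := by
  rcases lt_trichotomy k 0 with h | rfl | h
  · rw [constantCoeff_heis_neg h, if_neg h.ne]
  · rw [if_pos rfl, heis_zero]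
    simp
  · rw [heis_pos_one h, if_neg h.ne', map_zero]

lemma constantCoeff_der (n : ℤ) (f : Fock) : constantCoeff (der n f) = 0 := by
  induction f using MvPolynomial.induction_on with
  | C a => rw [derivation_C, map_zero]
  | add p q hp hq => rw [map_add, map_add, hp, hq, add_zero]
  | mul_X p k hp =>
    rw [Derivation.leibniz, map_add, smul_eq_mul, smul_eq_mul, map_mul, map_mul, hp, mul_zero,
      add_zero, der, mkDerivation_X]
    split_ifs <;> simp

lemma vir_pos_one {n : ℤ} (hn : 0 < n) : vir μ n 1 = 0 := by
  obtain ⟨j, rfl⟩ : ∃ j : ℕ, n = (j : ℤ) + 1 := ⟨(n - 1).toNat, by omega⟩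
  rw [vir, quad_pos, if_neg hn.ne']
  simp only [LinearMap.add_apply, LinearMap.smul_apply, LinearMap.sum_apply, Module.End.mul_apply]
  rw [heis_pos_one hn, Finset.sum_eq_zero, derivation_toLinearMap_apply,
    Derivation.map_one_eq_zero]
  · simp
  · intro i hi
    rw [heis_pos_one (by simp at hi; omega), map_zero]

lemma vir_zero : vir μ 0 = (der 0).toLinearMap + (μ ^ 2 / 4) • 1 := by
  rw [vir, quad_zero, if_pos rfl, add_zero]

lemma vir_zero_one : vir μ 0 1 = (μ ^ 2 / 4) • 1 := by
  rw [vir_zero]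
  simp

lemma constantCoeff_vir_neg {n : ℤ} (hn : n < 0) (f : Fock) :
    constantCoeff (vir μ n f) = 0 := by
  obtain ⟨j, rfl⟩ : ∃ j : ℕ, n = -((j : ℤ) + 1) := ⟨(-n - 1).toNat, by omega⟩
  rw [vir, quad_neg, if_neg hn.ne]
  simp only [LinearMap.add_apply, LinearMap.smul_apply, LinearMap.sum_apply, Module.End.mul_apply,
    map_add, derivation_toLinearMap_apply, constantCoeff_der,
    constantCoeff_smul, constantCoeff_heis_neg hn, map_sum]
  rw [Finset.sum_eq_zero]
  · simp
  · intro i _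
    rw [constantCoeff_heis_neg (by omega)]

lemma constantCoeff_vir_heis {m b : ℤ} (hm : 0 < m) :
    constantCoeff (vir μ m (heis μ b 1)) = if m + b = 0 then -b * μ else 0 := by
  rw [← sub_add_cancel (vir μ m (heis μ b 1)) (heis μ b (vir μ m 1)), ← brk_apply, brk_vir_heis,
    vir_pos_one hm, map_zero, add_zero, LinearMap.smul_apply, constantCoeff_smul,
    constantCoeff_heis_one]
  split_ifs <;> simp

lemma constantCoeff_vir_heis_heis {m a b : ℤ} (ha : a < 0) (hb : b < 0) :
    constantCoeff (vir μ m (heis μ a (heis μ b 1))) =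
      if m + a + b = 0 then ((-2 * a * (m + a) : ℤ) : ℂ) else 0 := by
  rw [← sub_add_cancel (vir μ m (heis μ a (heis μ b 1))) (heis μ a (vir μ m (heis μ b 1))),
    ← brk_apply, brk_vir_heis, map_add, constantCoeff_heis_neg ha, add_zero, LinearMap.smul_apply,
    constantCoeff_smul,
    ← sub_add_cancel (heis μ (m + a) (heis μ b 1)) (heis μ b (heis μ (m + a) 1)),
    ← brk_apply, brk_heis_heis, map_add, constantCoeff_heis_neg hb, add_zero]
  split_ifs
  · simp
    ring
  · simp

lemma sum_range_mul_sub (n : ℕ) :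
    ∑ j ∈ Finset.range n, ((j : ℂ) + 1) * ((n : ℂ) - j) = n * (n + 1) * (n + 2) / 6 := by
  have h1 : ∀ n : ℕ, ∑ j ∈ Finset.range n, ((j : ℂ) + 1) = n * (n + 1) / 2 := by
    intro n
    induction n with
    | zero => simp
    | succ n ih => rw [Finset.sum_range_succ, ih]; push_cast; ring
  induction n with
  | zero => simp
  | succ n ih =>
    have : ∑ j ∈ Finset.range n, ((j : ℂ) + 1) * (((n + 1 : ℕ) : ℂ) - j) =
        ∑ j ∈ Finset.range n, ((j : ℂ) + 1) * ((n : ℂ) - j) + ∑ j ∈ Finset.range n, ((j : ℂ) + 1) := by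
      rw [← Finset.sum_add_distrib]
      refine Finset.sum_congr rfl fun j _ => ?_
      push_cast
      ring
    rw [Finset.sum_range_succ, this, ih, h1]
    push_cast
    ring

lemma constantCoeff_vir_vir {m n : ℤ} (hm : 0 < m) (hn : n < 0) :
    constantCoeff (vir μ m (vir μ n 1)) =
      if m + n = 0 then ((m : ℂ) ^ 3 - m) / 12 + m * μ ^ 2 / 2 else 0 := by
  obtain ⟨j, rfl⟩ : ∃ j : ℕ, n = -((j : ℤ) + 1) := ⟨(-n - 1).toNat, by omega⟩
  have h1 : vir μ (-((j : ℤ) + 1)) 1 = (1 / 4 : ℂ) • ∑ i ∈ Finset.range j,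
      heis μ (-((i : ℤ) + 1)) (heis μ (-((j : ℤ) + 1) - -((i : ℤ) + 1)) 1) +
      (μ / 2) • heis μ (-((j : ℤ) + 1)) 1 := by
    rw [vir, quad_neg, if_neg hn.ne]
    simp [LinearMap.sum_apply]
  rw [h1, map_add, map_add, map_smul (vir μ m), map_smul (vir μ m), map_sum (vir μ m), constantCoeff_smul, constantCoeff_smul,
    map_sum, constantCoeff_vir_heis hm]
  have h2 : ∀ i ∈ Finset.range j, constantCoeff (vir μ m (heis μ (-((i : ℤ) + 1))
      (heis μ (-((j : ℤ) + 1) - -((i : ℤ) + 1)) 1))) =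
      if m + -((j : ℤ) + 1) = 0 then 2 * (((i : ℂ) + 1) * ((j : ℂ) - i)) else 0 := by
    intro i hi
    rw [Finset.mem_range] at hi
    rw [constantCoeff_vir_heis_heis (by omega) (by omega)]
    split_ifs with h1 h2 h2
    · rw [show m = (j : ℤ) + 1 by omega]
      push_cast
      ring
    · omega
    · omega
    · rfl
  rw [Finset.sum_congr rfl h2]
  split_ifs with h
  · rw [← Finset.mul_sum, sum_range_mul_sub, show m = (j : ℤ) + 1 by omega]
    simp only [smul_eq_mul]
    push_cast
    ring
  · simp

/-- The Virasoro relations at central charge `1` hold on the Fock space. -/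
theorem relations_vir : Relations (vir μ) := by
  intro m n f
  set T : Module.End ℂ Fock :=
    brk (vir μ m) (vir μ n) - ((m - n : ℤ) : ℂ) • vir μ (m + n) with hT
  have h0 : ∀ k, brk T (heis μ k) = 0 := by
    intro k
    rw [hT, brk_sub_left, brk_jacobi, brk_vir_heis, brk_vir_heis, brk_smul_right, brk_smul_right,
      brk_smul_left, brk_vir_heis, brk_vir_heis, brk_vir_heis, show m + (n + k) = m + n + k by ring,
      show n + (m + k) = m + n + k by ring]
    push_cast
    module
  have h1 := eq_smul_of_brk_heis_eq_zero h0 f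
  have hc : ∀ k : ℤ, constantCoeff (vir μ k 1) = if k = 0 then μ ^ 2 / 4 else 0 := by
    intro k
    rcases lt_trichotomy k 0 with h | rfl | h
    · rw [constantCoeff_vir_neg h, if_neg h.ne]
    · rw [vir_zero_one]; simp
    · rw [vir_pos_one h, map_zero, if_neg h.ne']
  have h2 : constantCoeff (T 1) = if m + n = 0 then ((m ^ 3 - m : ℤ) : ℂ) / 12 * 1 else 0 := by
    rw [hT, LinearMap.sub_apply, brk_apply, LinearMap.smul_apply, map_sub, map_sub,
      constantCoeff_smul, hc]
    have hz : ∀ k : ℤ, k ≠ 0 → constantCoeff (vir μ 0 (vir μ k 1)) = 0 := by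
      intro k hk
      rw [vir_zero]
      simp [constantCoeff_der, hc, hk, constantCoeff_smul]
    rcases lt_trichotomy m 0 with hm | rfl | hm <;> rcases lt_trichotomy n 0 with hn | rfl | hn
    · rw [constantCoeff_vir_neg hm, constantCoeff_vir_neg hn, if_neg (by omega), if_neg (by omega)]
      simp
    · rw [constantCoeff_vir_neg hm, hz _ hm.ne, if_neg (by omega), if_neg (by omega)]
      simp
    · rw [constantCoeff_vir_neg hm, constantCoeff_vir_vir hn hm, add_comm n m]
      split_ifs with h
      · rw [show m = -n by omega]
        push_cast
        simp only [smul_eq_mul]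
        ring
      · simp
    · rw [constantCoeff_vir_neg hn, hz _ hn.ne, if_neg (by omega), if_neg (by omega)]
      simp
    · simp
    · rw [vir_pos_one hn, vir_zero_one, map_smul, vir_pos_one hn, if_neg (by omega),
        if_neg (by omega)]
      simp
    · rw [constantCoeff_vir_neg hn, constantCoeff_vir_vir hm hn]
      split_ifs with h
      · rw [show n = -m by omega]
        push_cast
        simp only [smul_eq_mul]
        ring
      · simp
    · rw [vir_pos_one hm, vir_zero_one, map_smul, vir_pos_one hm, if_neg (by omega),
        if_neg (by omega)]
      simp
    · rw [vir_pos_one hm, vir_pos_one hn, if_neg (by omega), if_neg (by omega)]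
      simp
  rw [h2, hT] at h1
  rw [← h1]
  simp [brk_apply]

lemma highestWeight_vir : HighestWeight (vir μ) (μ ^ 2 / 4) 1 :=
  ⟨vir_zero_one, fun n hn => vir_pos_one (by omega)⟩

section Support

lemma pderiv_mem_supported {s : Set ℕ} {f : Fock} (hf : f ∈ supported ℂ s) (j : ℕ) :
    pderiv j f ∈ supported ℂ s := by
  rw [supported_eq_adjoin_X] at hf
  induction hf using Algebra.adjoin_induction with
  | mem x hx =>
    obtain ⟨i, _, rfl⟩ := hx
    rw [pderiv_X, Pi.single_apply]
    split_ifs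
    · exact one_mem _
    · exact zero_mem _
  | algebraMap r => simp
  | add x y _ _ hx hy => rw [map_add]; exact add_mem hx hy
  | mul x y hx' hy' hx hy =>
    rw [← supported_eq_adjoin_X] at hx' hy'
    rw [Derivation.leibniz]
    exact add_mem (mul_mem hx' hy) (mul_mem hy' hx)

lemma pderiv_eq_zero_of_mem_supported {s : Set ℕ} {f : Fock} (hf : f ∈ supported ℂ s) {j : ℕ}
    (hj : j ∉ s) : pderiv j f = 0 := by
  rw [supported_eq_adjoin_X] at hf
  induction hf using Algebra.adjoin_induction with
  | mem x hx =>
    obtain ⟨i, hi, rfl⟩ := hx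
    exact pderiv_X_of_ne fun h => hj (h ▸ hi)
  | algebraMap r => simp
  | add x y _ _ hx hy => rw [map_add, hx, hy, add_zero]
  | mul x y hx' hy' hx hy => rw [Derivation.leibniz, hx, hy, smul_zero, smul_zero, add_zero]

lemma derivation_aeval_of_mem_supported {R : Type*} [CommRing R] [Algebra ℂ R]
    (D : Derivation ℂ R R) (g : ℕ → R) {s : Finset ℕ} {f : Fock} (hf : f ∈ supported ℂ (s : Set ℕ)) :
    D (aeval g f) = ∑ j ∈ s, aeval g (pderiv j f) * D (g j) := by
  rw [supported_eq_adjoin_X] at hf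
  induction hf using Algebra.adjoin_induction with
  | mem x hx =>
    obtain ⟨i, hi, rfl⟩ := hx
    rw [aeval_X, Finset.sum_eq_single_of_mem i hi]
    · rw [pderiv_X_self, map_one, one_mul]
    · intro j _ hj
      rw [pderiv_X_of_ne hj.symm, map_zero, zero_mul]
  | algebraMap r => simp
  | add x y _ _ hx hy => simp only [map_add, hx, hy, add_mul, Finset.sum_add_distrib]
  | mul x y _ _ hx hy =>
    rw [map_mul, Derivation.leibniz, hx, hy, smul_eq_mul, smul_eq_mul, Finset.mul_sum,
      Finset.mul_sum, ← Finset.sum_add_distrib]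
    refine Finset.sum_congr rfl fun j _ => ?_
    rw [Derivation.leibniz, smul_eq_mul, smul_eq_mul, map_add, map_mul, map_mul]
    ring

end Support

section PowerSums

variable {N : ℕ}

/-- Evaluation of the Fock space at multiples of power sums of `N` variables. -/
noncomputable def powerEval (N : ℕ) (s : ℂ) : Fock →ₐ[ℂ] MvPolynomial (Fin N) ℂ :=
  aeval fun j => s • ∑ i : Fin N, X i ^ (j + 1)

lemma pderiv_powerEval {s : ℂ} {f : Fock} (hf : f ∈ supported ℂ (Finset.range N : Set ℕ))
    (i : Fin N) : pderiv i (powerEval N s f) =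
      s • ∑ j ∈ Finset.range N, X i ^ j * powerEval N s (((j : ℂ) + 1) • pderiv j f) := by
  rw [powerEval, derivation_aeval_of_mem_supported _ _ hf, Finset.smul_sum]
  refine Finset.sum_congr rfl fun j _ => ?_
  rw [Derivation.map_smul, map_sum, Finset.sum_eq_single_of_mem i (Finset.mem_univ _)]
  · rw [Derivation.leibniz_pow, pderiv_X_self, map_smul]
    simp only [Nat.add_sub_cancel, smul_eq_mul, mul_one, nsmul_eq_mul]
    simp only [Algebra.smul_def, map_add, map_natCast, map_one]
    push_cast
    ring
  · intro l _ hl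
    rw [Derivation.leibniz_pow, pderiv_X_of_ne hl, smul_zero, smul_zero]

lemma powerEval_injOn {s : ℂ} (hs : s ≠ 0) {f : Fock}
    (hf : f ∈ supported ℂ (Finset.range N : Set ℕ)) (h0 : powerEval N s f = 0) : f = 0 := by
  obtain ⟨n, hn⟩ : ∃ n, ∀ m ∈ f.support, m.degree < n :=
    ⟨f.support.sup Finsupp.degree + 1, fun m hm => Nat.lt_succ_of_le (Finset.le_sup hm)⟩
  induction n generalizing f with
  | zero =>
    by_contra hne
    obtain ⟨m, hm⟩ := Finset.nonempty_iff_ne_empty.2 (mt support_eq_empty.1 hne)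
    exact absurd (hn m hm) (by omega)
  | succ n ih =>
    have h1 : ∀ j : Fin N, powerEval N s (((j : ℕ) + 1 : ℂ) • pderiv (j : ℕ) f) = 0 := by
      refine congrFun (f := fun j : Fin N => powerEval N s (((j : ℕ) + 1 : ℂ) • pderiv (j : ℕ) f))
        (g := 0) ?_
      refine Matrix.eq_zero_of_mulVec_eq_zero
        (M := Matrix.vandermonde (X : Fin N → MvPolynomial (Fin N) ℂ))
        (Matrix.det_vandermonde_ne_zero_iff.2 X_injective) ?_
      funext i
      have := pderiv_powerEval (s := s) hf i
      rw [h0, map_zero, eq_comm, smul_eq_zero_iff_right hs, Finset.sum_range] at this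
      exact this
    have h2 : ∀ j, pderiv j f = 0 := by
      intro j
      by_cases hj : j < N
      · refine ih (pderiv_mem_supported hf j) ?_ ?_
        · have := h1 ⟨j, hj⟩
          rw [map_smul] at this
          exact (smul_eq_zero.1 this).resolve_left (Nat.cast_add_one_ne_zero _)
        · intro m hm
          rw [mem_support_iff, coeff_pderiv] at hm
          have := hn _ (mem_support_iff.2 (left_ne_zero_of_mul hm))
          rw [map_add, Finsupp.degree_single] at this
          omega
      · exact pderiv_eq_zero_of_mem_supported hf (by simpa using hj)
    have h3 := eq_C_of_pderiv_eq_zero h2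
    rw [h3, powerEval, aeval_C] at h0
    rw [h3, (algebraMap ℂ (MvPolynomial (Fin N) ℂ)).injective (h0.trans (map_zero _).symm), C_0]

/-- The Vandermonde polynomial. -/
noncomputable def vander (N : ℕ) : MvPolynomial (Fin N) ℂ := (Matrix.vandermonde X).det

lemma vander_ne_zero : vander N ≠ 0 := Matrix.det_vandermonde_ne_zero_iff.2 X_injective

/-- The Euler operator of a single variable. -/
noncomputable def euler (i : Fin N) : Derivation ℂ (MvPolynomial (Fin N) ℂ) (MvPolynomial (Fin N) ℂ) :=
  (X i : MvPolynomial (Fin N) ℂ) • pderiv i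

lemma coeff_euler (i : Fin N) (f : MvPolynomial (Fin N) ℂ) (m : Fin N →₀ ℕ) :
    coeff m (euler i f) = (m i : ℂ) * coeff m f := by
  rw [euler, Derivation.smul_apply, smul_eq_mul, coeff_X_mul']
  split_ifs with h
  · rw [coeff_pderiv, tsub_add_cancel_of_le
      (Finsupp.single_le_iff.2 (by have := Finsupp.mem_support_iff.1 h; omega)), mul_comm]
    congr 1
    have := Finsupp.mem_support_iff.1 h
    rw [Finsupp.tsub_apply, Finsupp.single_eq_same]
    have h2 : m i = (m i - 1) + 1 := by omega
    conv_rhs => rw [h2]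
    push_cast
    ring
  · rw [Finsupp.notMem_support_iff.1 h]
    simp

lemma exists_perm_of_coeff_vander_ne_zero {m : Fin N →₀ ℕ} (h : coeff m (vander N) ≠ 0) :
    ∃ σ : Equiv.Perm (Fin N), ∀ i, m (σ i) = i := by
  rw [vander, Matrix.det_apply, coeff_sum] at h
  obtain ⟨σ, _, hσ⟩ := Finset.exists_ne_zero_of_sum_ne_zero h
  refine ⟨σ, fun i => ?_⟩
  have h1 : ∏ i : Fin N, (Matrix.vandermonde (X : Fin N → MvPolynomial (Fin N) ℂ)) (σ i) i =
      monomial (∑ i : Fin N, Finsupp.single (σ i) (i : ℕ)) 1 := by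
    rw [monomial_sum_one]
    simp [Matrix.vandermonde_apply, X_pow_eq_monomial]
  rw [h1] at hσ
  have h2 : ∑ i : Fin N, Finsupp.single (σ i) (i : ℕ) = m := by
    by_contra hne
    apply hσ
    rw [coeff_smul, coeff_monomial, if_neg hne, smul_zero]
  rw [← h2, Finsupp.finsetSum_apply, Finset.sum_eq_single_of_mem i (Finset.mem_univ _)]
  · simp
  · intro j _ hj
    rw [Finsupp.single_apply, if_neg fun h => hj (σ.injective h)]

lemma sum_coeff_vander (F : ℕ → ℂ) (m : Fin N →₀ ℕ) :
    (∑ i, F (m i)) * coeff m (vander N) = (∑ j ∈ Finset.range N, F j) * coeff m (vander N) := by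
  by_cases h : coeff m (vander N) = 0
  · rw [h, mul_zero, mul_zero]
  · obtain ⟨σ, hσ⟩ := exists_perm_of_coeff_vander_ne_zero h
    rw [← Equiv.sum_comp σ, Finset.sum_range]
    simp only [hσ]

lemma sum_euler_vander : ∑ i, euler i (vander N) = (∑ j ∈ Finset.range N, (j : ℂ)) • vander N := by
  ext m
  simp only [coeff_sum, coeff_euler, coeff_smul, smul_eq_mul, ← Finset.sum_mul]
  exact sum_coeff_vander (fun j => (j : ℂ)) m

lemma sum_euler_euler_vander :
    ∑ i, euler i (euler i (vander N)) = (∑ j ∈ Finset.range N, (j : ℂ) ^ 2) • vander N := by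
  ext m
  simp only [coeff_sum, coeff_euler, coeff_smul, smul_eq_mul, ← mul_assoc, ← Finset.sum_mul]
  simp only [← pow_two]
  exact sum_coeff_vander (fun j => (j : ℂ) ^ 2) m

lemma derivation_prod_eq {R ι : Type*} [CommRing R] [Algebra ℂ R] (D : Derivation ℂ R R)
    (s : Finset ι) (f g : ι → R) (h : ∀ i ∈ s, D (f i) = f i * g i) :
    D (∏ i ∈ s, f i) = (∏ i ∈ s, f i) * ∑ i ∈ s, g i := by
  classical
  induction s using Finset.induction_on with
  | empty => simp
  | insert a s ha ih =>
    rw [Finset.prod_insert ha, Finset.sum_insert ha, Derivation.leibniz,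
      ih fun i hi => h i (Finset.mem_insert_of_mem hi), h a (Finset.mem_insert_self _ _)]
    simp only [smul_eq_mul]
    ring

lemma two_mul_sum_Ioi {R : Type*} [CommRing R] (h : Fin N → Fin N → R)
    (hs : ∀ i j, h i j = h j i) :
    2 * ∑ i, ∑ j ∈ Finset.Ioi i, h i j = ∑ i, ∑ j, h i j - ∑ i, h i i := by
  have h1 : ∀ i : Fin N, ∑ j, h i j =
      ∑ j ∈ Finset.Ioi i, h i j + ∑ j ∈ Finset.Iio i, h i j + h i i := by
    intro i
    have hu : (Finset.univ : Finset (Fin N)) = insert i (Finset.Ioi i ∪ Finset.Iio i) := by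
      ext j
      simp only [Finset.mem_univ, Finset.mem_insert, Finset.mem_union, Finset.mem_Ioi,
        Finset.mem_Iio, true_iff]
      rcases lt_trichotomy i j with h | h | h
      · exact Or.inr (Or.inl h)
      · exact Or.inl h.symm
      · exact Or.inr (Or.inr h)
    rw [hu, Finset.sum_insert (by simp), Finset.sum_union, add_comm]
    rw [Finset.disjoint_left]
    intro j hj hj'
    exact lt_asymm (Finset.mem_Ioi.1 hj) (Finset.mem_Iio.1 hj')
  have h2 : ∑ i, ∑ j ∈ Finset.Iio i, h i j = ∑ i, ∑ j ∈ Finset.Ioi i, h i j := by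
    rw [Finset.sum_comm' (t' := Finset.univ) (s' := fun j => Finset.Ioi j) (by simp)]
    exact Finset.sum_congr rfl fun i _ => Finset.sum_congr rfl fun j _ => hs j i
  simp only [h1, Finset.sum_add_distrib, h2]
  ring

lemma two_mul_sum_pow_mul_euler_vander (k : ℕ) :
    2 * ∑ i, X i ^ k * euler i (vander N) = vander N *
      (∑ r ∈ Finset.range (k + 1), (∑ i, X i ^ r) * (∑ i, X i ^ (k - r)) -
        ((k : MvPolynomial (Fin N) ℂ) + 1) * ∑ i, X i ^ k) := by
  let D : Derivation ℂ (MvPolynomial (Fin N) ℂ) (MvPolynomial (Fin N) ℂ) :=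
    ∑ i, (X i ^ k : MvPolynomial (Fin N) ℂ) • euler i
  have hD : ∀ f, D f = ∑ i, X i ^ k * euler i f := by
    intro f
    simp only [D, ← Derivation.coeFnAddMonoidHom_apply, map_sum, Finset.sum_apply]
    rfl
  have hX : ∀ i, D (X i) = X i ^ (k + 1) := by
    intro i
    rw [hD, Finset.sum_eq_single_of_mem i (Finset.mem_univ _)]
    · simp [euler, pow_succ]
    · intro j _ hj
      simp [euler, pderiv_X_of_ne hj.symm]
  let g : Fin N → Fin N → MvPolynomial (Fin N) ℂ :=
    fun i j => ∑ r ∈ Finset.range (k + 1), X i ^ r * X j ^ (k - r)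
  have hfac : ∀ i j, D (X j - X i) = (X j - X i) * g i j := by
    intro i j
    have := (Commute.all (X i : MvPolynomial (Fin N) ℂ) (X j)).mul_geom_sum₂ (k + 1)
    rw [map_sub, hX, hX]
    simp only [g]
    simp only [Nat.add_sub_cancel] at this
    linear_combination this
  have hg : ∀ i j, g i j = g j i := by
    intro i j
    simp only [g]
    rw [← Finset.sum_range_reflect]
    refine Finset.sum_congr rfl fun r hr => ?_
    have := Finset.mem_range.1 hr
    rw [show k + 1 - 1 - r = k - r by omega, show k - (k - r) = r by omega, mul_comm]
  rw [← hD, vander, Matrix.det_vandermonde,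
    derivation_prod_eq D _ _ (fun i => ∑ j ∈ Finset.Ioi i, g i j) fun i _ =>
      derivation_prod_eq D _ _ _ fun j _ => hfac i j, mul_left_comm, two_mul_sum_Ioi g hg]
  congr 2
  · simp only [g, Finset.sum_mul_sum]
    rw [Finset.sum_comm (s := Finset.range (k + 1))]
    exact Finset.sum_congr rfl fun i _ => Finset.sum_comm
  · rw [Finset.mul_sum]
    refine Finset.sum_congr rfl fun i _ => ?_
    simp only [g]
    rw [Finset.sum_congr rfl fun r hr => by
      rw [← pow_add, show r + (k - r) = k by have := Finset.mem_range.1 hr; omega]]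
    simp

end PowerSums

/-- The rescaled annihilation operators `(j + 1) ∂ⱼ`. -/
noncomputable def ann (j : ℕ) : Derivation ℂ Fock Fock := ((j : ℂ) + 1) • pderiv j

/-- The grading operator in the first `N` variables. -/
noncomputable def grade (N : ℕ) (f : Fock) : Fock := ∑ j ∈ Finset.range N, X j * ann j f

/-- The join operator in the first `N` variables. -/
noncomputable def join (N : ℕ) (f : Fock) : Fock :=
  ∑ j ∈ Finset.range N, ∑ i ∈ Finset.range N, X (i + j + 1) * ann i (ann j f)

/-- The cut operator in the first `N` variables. -/
noncomputable def cut (N : ℕ) (f : Fock) : Fock :=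
  ∑ j ∈ Finset.range N, ∑ r ∈ Finset.range j, X r * X (j - 1 - r) * ann j f

lemma ann_mem_supported {s : Set ℕ} {f : Fock} (hf : f ∈ supported ℂ s) (j : ℕ) :
    ann j f ∈ supported ℂ s :=
  Subalgebra.smul_mem _ (pderiv_mem_supported hf j) _

section JoinCut

variable {N : ℕ} {s : ℂ} {f : Fock}

lemma powerEval_X (j : ℕ) : powerEval N s (X j) = s • ∑ i, X i ^ (j + 1) := aeval_X _ _

lemma euler_powerEval (hf : f ∈ supported ℂ (Finset.range N : Set ℕ)) (i : Fin N) :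
    euler i (powerEval N s f) =
      s • ∑ j ∈ Finset.range N, X i ^ (j + 1) * powerEval N s (ann j f) := by
  rw [euler, Derivation.smul_apply, pderiv_powerEval hf, smul_comm, smul_eq_mul, Finset.mul_sum]
  congr 1
  refine Finset.sum_congr rfl fun j _ => ?_
  rw [← mul_assoc, ← pow_succ']
  rfl

lemma euler_X_pow (i : Fin N) (k : ℕ) : euler i (X i ^ k) = (k : ℂ) • X i ^ k := by
  ext m
  rw [coeff_euler, coeff_smul, smul_eq_mul, coeff_X_pow]
  split_ifs with h
  · simp [← h]
  · simp

lemma sum_euler_powerEval (hf : f ∈ supported ℂ (Finset.range N : Set ℕ)) :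
    ∑ i, euler i (powerEval N s f) = powerEval N s (grade N f) := by
  simp only [euler_powerEval hf, grade, map_sum, map_mul, powerEval_X, smul_mul_assoc,
    Finset.smul_sum, Finset.sum_mul]
  exact Finset.sum_comm

lemma sum_euler_euler_powerEval (hf : f ∈ supported ℂ (Finset.range N : Set ℕ)) :
    ∑ i, euler i (euler i (powerEval N s f)) = powerEval N s
      (∑ j ∈ Finset.range N, ((j : ℂ) + 1) • (X j * ann j f) + s • join N f) := by
  have h1 : ∀ i : Fin N, euler i (euler i (powerEval N s f)) =
      ∑ j ∈ Finset.range N, ((j : ℂ) + 1) • s • (X i ^ (j + 1) * powerEval N s (ann j f)) +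
      ∑ j ∈ Finset.range N, ∑ l ∈ Finset.range N,
        s • s • (X i ^ (l + j + 1 + 1) * powerEval N s (ann l (ann j f))) := by
    intro i
    rw [euler_powerEval hf, Derivation.map_smul, map_sum, Finset.smul_sum,
      ← Finset.sum_add_distrib]
    refine Finset.sum_congr rfl fun j _ => ?_
    rw [Derivation.leibniz, euler_X_pow, euler_powerEval (ann_mem_supported hf j), smul_eq_mul,
      smul_eq_mul, smul_add, add_comm]
    congr 1
    · push_cast
      rw [mul_comm, smul_mul_assoc, smul_comm]
    · rw [Finset.smul_sum, Finset.mul_sum, Finset.smul_sum]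
      refine Finset.sum_congr rfl fun l _ => ?_
      rw [mul_smul_comm, ← mul_assoc, ← pow_add, show j + 1 + (l + 1) = l + j + 1 + 1 by ring]
  simp only [h1, join, map_sum, map_add, map_mul, map_smul, powerEval_X, smul_mul_assoc,
    Finset.smul_sum, Finset.sum_mul, Finset.sum_add_distrib]
  congr 1
  · exact Finset.sum_comm
  · rw [Finset.sum_comm]
    exact Finset.sum_congr rfl fun j _ => Finset.sum_comm

lemma two_mul_sum_euler_vander_mul_euler (hs : s ≠ 0)
    (hf : f ∈ supported ℂ (Finset.range N : Set ℕ)) :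
    2 * ∑ i, euler i (vander N) * euler i (powerEval N s f) = vander N * powerEval N s
      (∑ j ∈ Finset.range N, (2 * (N : ℂ) - j - 2) • (X j * ann j f) + s⁻¹ • cut N f) := by
  have h1 : 2 * ∑ i, euler i (vander N) * euler i (powerEval N s f) =
      ∑ j ∈ Finset.range N, s • ((2 * ∑ i, X i ^ (j + 1) * euler i (vander N)) *
        powerEval N s (ann j f)) := by
    simp only [euler_powerEval hf, Finset.mul_sum, Finset.smul_sum, Finset.sum_mul]
    rw [Finset.sum_comm]
    refine Finset.sum_congr rfl fun j _ => Finset.sum_congr rfl fun i _ => ?_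
    simp only [Algebra.smul_def]
    ring
  have h2 : ∀ j : ℕ, s • ((∑ r ∈ Finset.range (j + 1 + 1),
      (∑ i : Fin N, (X i : MvPolynomial (Fin N) ℂ) ^ r) * (∑ i, X i ^ (j + 1 - r)) -
        (((j + 1 : ℕ) : MvPolynomial (Fin N) ℂ) + 1) * ∑ i, X i ^ (j + 1))) =
      powerEval N s ((2 * (N : ℂ) - j - 2) • X j +
        s⁻¹ • ∑ r ∈ Finset.range j, X r * X (j - 1 - r)) := by
    intro j
    rw [Finset.sum_range_succ, Finset.sum_range_succ']
    simp only [map_add, map_smul, map_sum, map_mul, powerEval_X]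
    have h3 : ∑ r ∈ Finset.range j, (s • ∑ i : Fin N, (X i : MvPolynomial (Fin N) ℂ) ^ (r + 1)) *
        (s • ∑ i, X i ^ (j - 1 - r + 1)) = (s * s) • ∑ r ∈ Finset.range j,
        (∑ i : Fin N, (X i : MvPolynomial (Fin N) ℂ) ^ (r + 1)) *
          ∑ i, X i ^ (j + 1 - (r + 1)) := by
      rw [Finset.smul_sum]
      refine Finset.sum_congr rfl fun r hr => ?_
      have := Finset.mem_range.1 hr
      rw [smul_mul_smul_comm, show j - 1 - r + 1 = j + 1 - (r + 1) by omega]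
    rw [h3, smul_smul s⁻¹, inv_mul_cancel_left₀ hs]
    simp only [pow_zero, Finset.sum_const, Finset.card_univ, Fintype.card_fin, nsmul_eq_mul,
      mul_one, Nat.sub_self, Nat.sub_zero]
    simp only [Algebra.smul_def, map_sub, map_mul, map_natCast, map_ofNat]
    push_cast
    ring
  rw [h1, map_add, map_sum, map_smul, cut, map_sum, Finset.smul_sum, ← Finset.sum_add_distrib,
    Finset.mul_sum]
  refine Finset.sum_congr rfl fun j _ => ?_
  rw [two_mul_sum_pow_mul_euler_vander, mul_assoc, ← mul_smul_comm, ← smul_mul_assoc, h2]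
  congr 1
  rw [← map_mul, ← map_smul, ← map_add, add_mul, smul_mul_assoc, smul_mul_assoc, Finset.sum_mul]

/-- The operator `s J + s⁻¹ K + μ D`, with `J`, `K`, `D` the join, cut and grading operators, is
injective in positive degrees when `μ` is irrational. -/
lemma grade_eq_zero_of_join_cut (hs : s ≠ 0) {μ : ℂ}
    (hμ : ∀ a b : ℤ, (a : ℂ) = b * μ → b = 0)
    (hf : f ∈ supported ℂ (Finset.range N : Set ℕ))
    (h : s • join N f + s⁻¹ • cut N f + μ • grade N f = 0) : grade N f = 0 := by
  set ψ := vander N * powerEval N s f with hψ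
  have e1 : ∑ i, euler i ψ = (∑ j ∈ Finset.range N, (j : ℂ)) • ψ +
      vander N * powerEval N s (grade N f) := by
    simp only [hψ, Derivation.leibniz, Finset.sum_add_distrib, smul_eq_mul, ← Finset.mul_sum]
    rw [sum_euler_powerEval hf, sum_euler_vander, mul_smul_comm, add_comm,
      mul_comm (powerEval N s f)]
  have e2 : ∑ i, euler i (euler i ψ) = (∑ j ∈ Finset.range N, (j : ℂ) ^ 2) • ψ +
      (2 * (N : ℂ) - 1 - μ) • (vander N * powerEval N s (grade N f)) := by
    have h1 : ∀ i, euler i (euler i ψ) = powerEval N s f * euler i (euler i (vander N)) +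
        2 * (euler i (vander N) * euler i (powerEval N s f)) +
        vander N * euler i (euler i (powerEval N s f)) := by
      intro i
      simp only [hψ, Derivation.leibniz, map_add, smul_eq_mul]
      ring
    simp only [h1, Finset.sum_add_distrib, ← Finset.mul_sum]
    rw [sum_euler_euler_vander, two_mul_sum_euler_vander_mul_euler hs hf,
      sum_euler_euler_powerEval hf, add_assoc, ← mul_add, ← map_add, mul_smul_comm,
      mul_comm (powerEval N s f), ← mul_smul_comm (2 * (N : ℂ) - 1 - μ),
      ← map_smul (powerEval N s)]
    congr 3
    have h2 : ∑ j ∈ Finset.range N, (2 * (N : ℂ) - j - 2) • (X j * ann j f) +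
        ∑ j ∈ Finset.range N, ((j : ℂ) + 1) • (X j * ann j f) =
        (2 * (N : ℂ) - 1) • grade N f := by
      rw [grade, Finset.smul_sum, ← Finset.sum_add_distrib]
      refine Finset.sum_congr rfl fun j _ => ?_
      rw [← add_smul]
      congr 1
      ring
    rw [sub_smul, ← h2]
    linear_combination (exp := 1) h
  have e3 : ∑ i, euler i ψ - (∑ j ∈ Finset.range N, (j : ℂ)) • ψ = 0 := by
    have h1 : ∑ i, euler i (euler i ψ) - (∑ j ∈ Finset.range N, (j : ℂ) ^ 2) • ψ =
        (2 * (N : ℂ) - 1 - μ) • (∑ i, euler i ψ - (∑ j ∈ Finset.range N, (j : ℂ)) • ψ) := by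
      rw [e1, e2, add_sub_cancel_left, add_sub_cancel_left]
    ext m
    have h2 := congrArg (coeff m) h1
    simp only [coeff_sub, coeff_sum, coeff_euler, coeff_smul, smul_eq_mul, ← mul_assoc,
      ← Finset.sum_mul, ← sub_mul] at h2
    simp only [coeff_sub, coeff_sum, coeff_euler, coeff_smul, smul_eq_mul, ← Finset.sum_mul,
      ← sub_mul, coeff_zero]
    by_cases h3 : coeff m ψ = 0
    · rw [h3, mul_zero]
    · have h4 := mul_right_cancel₀ h3 h2
      have h5 := hμ ((2 * N - 1) * (∑ i, (m i : ℤ) - ∑ j ∈ Finset.range N, (j : ℤ)) -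
        (∑ i, (m i : ℤ) * m i - ∑ j ∈ Finset.range N, (j : ℤ) ^ 2))
        (∑ i, (m i : ℤ) - ∑ j ∈ Finset.range N, (j : ℤ)) (by
          push_cast
          linear_combination -h4)
      have h6 := congrArg (Int.cast (R := ℂ)) h5
      push_cast at h6
      rw [h6, zero_mul]
  rw [e1, add_sub_cancel_left, mul_eq_zero] at e3
  refine powerEval_injOn hs ?_ (e3.resolve_left vander_ne_zero)
  refine sum_mem fun j hj => mul_mem ?_ (ann_mem_supported hf j)
  exact X_mem_supported.2 hj

end JoinCut

/-- The weight of a monomial of the Fock space. -/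
noncomputable abbrev lvl : (ℕ →₀ ℕ) →+ ℕ := Finsupp.weight fun i => i + 1

/-- The weight spaces of the Fock space. -/
noncomputable abbrev level (n : ℕ) : Submodule ℂ Fock :=
  weightedHomogeneousSubmodule ℂ (fun i => i + 1) n

lemma exists_mem_supported_range (f : Fock) :
    ∃ N, f ∈ supported ℂ (Finset.range N : Set ℕ) := by
  refine ⟨f.vars.sup id + 1, mem_supported.2 fun i hi => ?_⟩
  exact Finset.mem_coe.2 (Finset.mem_range.2 (Nat.lt_succ_of_le (Finset.le_sup (f := id) hi)))

lemma supported_range_mono {K N : ℕ} (h : K ≤ N) {f : Fock}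
    (hf : f ∈ supported ℂ (Finset.range K : Set ℕ)) : f ∈ supported ℂ (Finset.range N : Set ℕ) :=
  supported_mono (Finset.coe_subset.2 (Finset.range_mono h)) hf

lemma der_of_mem_supported {N : ℕ} {f : Fock} (hf : f ∈ supported ℂ (Finset.range N : Set ℕ))
    (n : ℤ) : der n f =
      ∑ j ∈ Finset.range N, (if n ≤ j then X (j - n).toNat else 0) * ann j f := by
  have := derivation_aeval_of_mem_supported (der n) X hf
  rw [aeval_X_left, AlgHom.id_apply] at this
  rw [this]
  refine Finset.sum_congr rfl fun j _ => ?_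
  rw [AlgHom.id_apply, der, mkDerivation_X, ann, Derivation.smul_apply]
  split_ifs
  · rw [mul_smul_comm, mul_smul_comm, mul_comm]
  · rw [mul_zero, zero_mul]

lemma der_zero_eq_grade {N : ℕ} {f : Fock} (hf : f ∈ supported ℂ (Finset.range N : Set ℕ)) :
    der 0 f = grade N f := by
  rw [der_of_mem_supported hf, grade]
  refine Finset.sum_congr rfl fun j _ => ?_
  rw [if_pos (by omega), sub_zero, Int.toNat_natCast]

lemma der_zero_monomial (m : ℕ →₀ ℕ) (a : ℂ) :
    der 0 (monomial m a) = (lvl m : ℂ) • monomial m a := by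
  induction m using Finsupp.induction_linear generalizing a with
  | zero =>
    rw [map_zero, Nat.cast_zero, zero_smul]
    exact derivation_C _ a
  | add m₁ m₂ h₁ h₂ =>
    rw [show monomial (m₁ + m₂) a = monomial m₁ a * monomial m₂ 1 by
      rw [monomial_mul, mul_one], Derivation.leibniz, h₁, h₂, map_add]
    push_cast
    simp only [smul_eq_mul, add_smul, mul_smul_comm, mul_comm]
    rw [add_comm]
  | single i k =>
    rw [← C_mul_X_pow_eq_monomial, Derivation.leibniz, derivation_C, smul_zero, add_zero,
      Derivation.leibniz_pow, der, mkDerivation_X, if_pos (by omega), sub_zero, Int.toNat_natCast,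
      Finsupp.weight_single]
    rcases k with _ | k
    · simp
    · simp only [nsmul_eq_mul, Nat.add_sub_cancel, smul_eq_mul]
      simp only [Algebra.smul_def, map_add, map_natCast, map_one, Nat.cast_mul, map_mul]
      push_cast
      ring

lemma coeff_der_zero (m : ℕ →₀ ℕ) (f : Fock) :
    coeff m (der 0 f) = (lvl m : ℂ) * coeff m f := by
  induction f using MvPolynomial.induction_on' with
  | monomial m' a =>
    rw [der_zero_monomial, coeff_smul, coeff_monomial, smul_eq_mul]
    split_ifs with h
    · rw [h]
    · rw [mul_zero, mul_zero]
  | add p q hp hq => rw [map_add, coeff_add, hp, hq, coeff_add, mul_add]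

lemma mem_level_iff {n : ℕ} {f : Fock} : f ∈ level n ↔ der 0 f = (n : ℂ) • f := by
  rw [mem_weightedHomogeneousSubmodule, IsWeightedHomogeneous]
  constructor
  · intro h
    ext m
    rw [coeff_der_zero, coeff_smul, smul_eq_mul]
    by_cases hm : coeff m f = 0
    · rw [hm, mul_zero, mul_zero]
    · rw [h hm]
  · intro h m hm
    have := congrArg (coeff m) h
    rw [coeff_der_zero, coeff_smul, smul_eq_mul] at this
    exact_mod_cast mul_right_cancel₀ hm this

lemma monomial_mem_level (m : ℕ →₀ ℕ) (a : ℂ) : monomial m a ∈ level (lvl m) :=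
  mem_level_iff.2 (der_zero_monomial m a)

lemma eq_C_of_der_zero {f : Fock} (h : der 0 f = 0) : f = C (constantCoeff f) := by
  ext m
  rw [coeff_C]
  split_ifs with hm
  · rw [← hm]; rfl
  · have := coeff_der_zero m f
    rw [h, coeff_zero, eq_comm, mul_eq_zero] at this
    refine this.resolve_left fun h0 => hm ?_
    have h1 : lvl m = 0 := by exact_mod_cast h0
    have : Finsupp.NonTorsionWeight ℕ (fun i : ℕ => i + 1) :=
      Finsupp.nonTorsionWeight_of (R := ℕ) (w := fun i : ℕ => i + 1) fun i => Nat.succ_ne_zero i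
    exact ((Finsupp.weight_eq_zero_iff_eq_zero _).1 h1).symm

lemma der_zero_vir (k : ℤ) (f : Fock) :
    der 0 (vir μ k f) = vir μ k (der 0 f) - (k : ℂ) • vir μ k f := by
  have h := relations_vir (μ := μ) 0 k f
  rw [vir_zero] at h
  have h0 : (if (0 : ℤ) + k = 0 then (((0 : ℤ) ^ 3 - 0 : ℤ) : ℂ) / 12 * 1 else 0) = 0 := by simp
  rw [h0, zero_add] at h
  simp only [LinearMap.add_apply, derivation_toLinearMap_apply, LinearMap.smul_apply,
    Module.End.one_apply, map_add, map_smul, zero_smul, add_zero] at h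
  push_cast at h
  rw [zero_sub, neg_smul] at h
  linear_combination (exp := 1) h

lemma exists_of_coeff_vir_ne_zero {k : ℤ} {f : Fock} {m' : ℕ →₀ ℕ}
    (h : coeff m' (vir μ k f) ≠ 0) : ∃ m ∈ f.support, (lvl m' : ℤ) + k = lvl m := by
  rw [← support_sum_monomial_coeff f, map_sum, coeff_sum] at h
  obtain ⟨m, hm, h1⟩ := Finset.exists_ne_zero_of_sum_ne_zero h
  refine ⟨m, hm, ?_⟩
  have h2 := congrArg (coeff m') (der_zero_vir (μ := μ) k (monomial m (coeff m f)))
  rw [coeff_der_zero, der_zero_monomial, map_smul, coeff_sub, coeff_smul, coeff_smul, smul_eq_mul,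
    smul_eq_mul, ← sub_mul] at h2
  have h3 := mul_right_cancel₀ h1 h2
  have h4 : (((lvl m' : ℤ) + k : ℤ) : ℂ) = ((lvl m : ℤ) : ℂ) := by
    push_cast
    rw [h3]
    ring
  exact_mod_cast h4

lemma ann_eq_zero {K j : ℕ} {f : Fock} (hf : f ∈ supported ℂ (Finset.range K : Set ℕ))
    (hj : K ≤ j) : ann j f = 0 := by
  rw [ann, Derivation.smul_apply, pderiv_eq_zero_of_mem_supported hf (by simpa using hj), smul_zero]

lemma heis_natCast_add_one_apply (k : ℕ) (f : Fock) :
    heis μ ((k : ℤ) + 1) f = (2 : ℂ) • ann k f := by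
  rw [heis_natCast_add_one, mul_smul]
  rfl

lemma sum_range_antidiagonal {K N : ℕ} (hN : 2 * K ≤ N) (G : ℕ → ℕ → Fock)
    (hG : ∀ i j, K ≤ i ∨ K ≤ j → G i j = 0) :
    ∑ k ∈ Finset.range N, ∑ i ∈ Finset.range k, G i (k - 1 - i) =
      ∑ j ∈ Finset.range N, ∑ i ∈ Finset.range N, G i j := by
  rw [Finset.sum_sigma', Finset.sum_sigma']
  refine Finset.sum_bij_ne_zero (fun a _ _ => ⟨a.1 - 1 - a.2, a.2⟩) ?_ ?_ ?_ ?_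
  · rintro ⟨k, i⟩ h _
    simp only [Finset.mem_sigma, Finset.mem_range] at h ⊢
    omega
  · rintro ⟨k, i⟩ h _ ⟨k', i'⟩ h' _ he
    simp only [Finset.mem_sigma, Finset.mem_range, Sigma.mk.injEq, heq_eq_eq] at h h' he ⊢
    omega
  · rintro ⟨j, i⟩ h h'
    have h1 : i < K ∧ j < K := by
      by_contra hc
      exact h' (hG i j (by omega))
    refine ⟨⟨i + j + 1, i⟩, ?_, ?_, ?_⟩
    · simp only [Finset.mem_sigma, Finset.mem_range]
      omega
    · simpa [show i + j - i = j by omega] using h'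
    · simp [show i + j - i = j by omega]
  · intros
    rfl

lemma sum_X_mul_vir {K N : ℕ} (hN : 2 * K ≤ N) {f : Fock}
    (hf : f ∈ supported ℂ (Finset.range K : Set ℕ)) :
    ∑ k ∈ Finset.range N, X k * vir μ ((k : ℤ) + 1) f =
      join N f + cut N f + μ • grade N f := by
  have h1 : ∀ k : ℕ, vir μ ((k : ℤ) + 1) f =
      ∑ j ∈ Finset.range N, (if k < j then X (j - 1 - k) * ann j f else 0) +
      ∑ i ∈ Finset.range k, ann i (ann (k - 1 - i) f) + μ • ann k f := by
    intro k
    rw [vir, if_neg (by omega), quad_pos]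
    simp only [LinearMap.add_apply, derivation_toLinearMap_apply, LinearMap.smul_apply,
      LinearMap.sum_apply, Module.End.mul_apply]
    congr 1
    · congr 1
      · rw [der_of_mem_supported (supported_range_mono (show K ≤ N by omega) hf)]
        refine Finset.sum_congr rfl fun j _ => ?_
        split_ifs
        · congr 2
          omega
        · omega
        · omega
        · rw [zero_mul]
      · rw [Finset.smul_sum]
        refine Finset.sum_congr rfl fun i hi => ?_
        have := Finset.mem_range.1 hi
        rw [show (k : ℤ) + 1 - ((i : ℤ) + 1) = ((k - 1 - i : ℕ) : ℤ) + 1 by omega,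
          heis_natCast_add_one_apply, heis_natCast_add_one_apply, Derivation.map_smul, smul_smul, smul_smul]
        norm_num
    · rw [heis_natCast_add_one_apply, smul_smul]
      congr 1
      ring
  simp only [h1, mul_add, Finset.sum_add_distrib]
  rw [add_comm (join N f)]
  congr 1
  · congr 1
    · simp only [cut, Finset.mul_sum]
      rw [Finset.sum_comm]
      refine Finset.sum_congr rfl fun j hj => ?_
      have := Finset.mem_range.1 hj
      have h2 : Finset.range j = (Finset.range N).filter (· < j) := by
        ext i
        simp only [Finset.mem_range, Finset.mem_filter]
        omega
      rw [h2, Finset.sum_filter]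
      refine Finset.sum_congr rfl fun i _ => ?_
      split_ifs
      · rw [mul_assoc]
      · rw [mul_zero]
    · rw [join, ← sum_range_antidiagonal hN (fun i j => X (i + j + 1) * ann i (ann j f))]
      · refine Finset.sum_congr rfl fun k _ => ?_
        rw [Finset.mul_sum]
        refine Finset.sum_congr rfl fun i hi => ?_
        have := Finset.mem_range.1 hi
        rw [show i + (k - 1 - i) + 1 = k by omega]
      · rintro i j (h | h)
        · rw [ann_eq_zero (ann_mem_supported hf j) h, mul_zero]
        · rw [ann_eq_zero hf h, map_zero, mul_zero]
  · simp only [grade, mul_smul_comm, Finset.smul_sum]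

lemma sum_vir_ann {N : ℕ} {f : Fock} (hf : f ∈ supported ℂ (Finset.range N : Set ℕ)) :
    (2 : ℂ) • ∑ k ∈ Finset.range N, vir μ (-((k : ℤ) + 1)) (ann k f) =
      (2 : ℂ) • join N f + (2 : ℂ)⁻¹ • cut N f + μ • grade N f := by
  simp only [join, cut, grade, Finset.smul_sum, ← Finset.sum_add_distrib]
  refine Finset.sum_congr rfl fun k _ => ?_
  rw [vir, if_neg (by omega), quad_neg]
  simp only [LinearMap.add_apply, derivation_toLinearMap_apply, LinearMap.smul_apply,
    LinearMap.sum_apply, Module.End.mul_apply, smul_add, smul_smul, heis_neg_natCast_add_one,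
    LinearMap.mulLeft_apply]
  congr 1
  · congr 1
    · rw [der_of_mem_supported (ann_mem_supported hf k), Finset.smul_sum]
      refine Finset.sum_congr rfl fun j _ => ?_
      rw [if_pos (by omega)]
      congr 3
    · rw [Finset.smul_sum]
      refine Finset.sum_congr rfl fun i hi => ?_
      have := Finset.mem_range.1 hi
      rw [show -((k : ℤ) + 1) - -((i : ℤ) + 1) = -(((k - 1 - i : ℕ) : ℤ) + 1) by omega,
        heis_neg_natCast_add_one, LinearMap.mulLeft_apply, mul_assoc]
      norm_num
  · congr 1
    ring

lemma finite_lvl (n : ℕ) : {m : ℕ →₀ ℕ | lvl m = n}.Finite := by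
  refine (Set.finite_Iic (∑ i ∈ Finset.range n, Finsupp.single i n)).subset fun m hm i => ?_
  rw [Finsupp.finsetSum_apply]
  by_cases h : m i = 0
  · rw [h]
    exact Nat.zero_le _
  · have h1 : i + 1 ≤ n :=
      (Finsupp.le_weight_of_ne_zero' (fun i : ℕ => i + 1) h).trans (le_of_eq hm)
    have h2 : m i ≤ n :=
      (Finsupp.le_weight (fun i : ℕ => i + 1) (s := i) (by omega) m).trans (le_of_eq hm)
    refine h2.trans ((le_of_eq ?_).trans (Finset.single_le_sum
      (f := fun j => (Finsupp.single j n : ℕ →₀ ℕ) i) (fun _ _ => Nat.zero_le _)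
      (Finset.mem_range.2 (Nat.lt_of_succ_le h1))))
    exact Finsupp.single_eq_same.symm

instance finite_level (n : ℕ) : Module.Finite ℂ (level n) := by
  have := FiniteDimensional.span_of_finite ℂ
    ((finite_lvl n).image fun m => (monomial m (1 : ℂ) : Fock))
  refine Submodule.finiteDimensional_of_le (S₂ := Submodule.span ℂ
    ((fun m => (monomial m (1 : ℂ) : Fock)) '' {m | lvl m = n})) fun f hf => ?_
  rw [← support_sum_monomial_coeff f]
  refine Submodule.sum_mem _ fun m hm => ?_
  rw [← mul_one (coeff m f), ← smul_eq_mul, ← smul_monomial]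
  exact Submodule.smul_mem _ _ (Submodule.subset_span ⟨m, hf (mem_support_iff.1 hm), rfl⟩)

lemma level_le_supported {n : ℕ} {f : Fock} (hf : f ∈ level n) :
    f ∈ supported ℂ (Finset.range n : Set ℕ) := by
  refine mem_supported.2 fun i hi => ?_
  obtain ⟨m, hm, him⟩ := (mem_vars_iff_mem_support i).1 hi
  have h1 : i + 1 ≤ lvl m :=
    Finsupp.le_weight_of_ne_zero' (fun i : ℕ => i + 1) (Finsupp.mem_support_iff.1 him)
  have h2 : lvl m = n := hf (mem_support_iff.1 hm)
  simp only [Finset.coe_range, Set.mem_Iio]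
  omega

lemma vir_mem_level {n n' : ℕ} {k : ℤ} (h : (n' : ℤ) + k = n) {f : Fock} (hf : f ∈ level n) :
    vir μ k f ∈ level n' := by
  rw [mem_level_iff] at hf ⊢
  rw [der_zero_vir, hf, map_smul, ← sub_smul]
  congr 1
  have : ((n' : ℤ) + k : ℂ) = (n : ℤ) := by exact_mod_cast h
  push_cast at this
  rw [← this]
  ring

lemma ann_mem_level {n n' k : ℕ} (h : n' + (k + 1) = n) {f : Fock} (hf : f ∈ level n) :
    ann k f ∈ level n' := by
  intro m hm
  rw [ann, Derivation.smul_apply, coeff_smul, smul_eq_mul] at hm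
  have h1 := right_ne_zero_of_mul hm
  rw [coeff_pderiv] at h1
  have h2 := hf (left_ne_zero_of_mul h1)
  rw [map_add, Finsupp.weight_single] at h2
  simp only [smul_eq_mul, one_mul] at h2
  omega

/-- A nonzero Virasoro-invariant subspace of the Fock space contains the vacuum. -/
lemma mem_of_vir_invariant (hμ : ∀ a b : ℤ, (a : ℂ) = b * μ → b = 0) {N : Submodule ℂ Fock}
    (hN : ∀ n : ℤ, ∀ x ∈ N, vir μ n x ∈ N) (h0 : N ≠ ⊥) : (1 : Fock) ∈ N := by
  classical
  have hex : ∃ b : ℕ, ∃ x ∈ N, x ≠ 0 ∧ ∀ m ∈ x.support, lvl m < b := by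
    obtain ⟨x, hx, hx0⟩ := Submodule.exists_mem_ne_zero_of_ne_bot h0
    exact ⟨x.support.sup lvl + 1, x, hx, hx0, fun m hm => Nat.lt_succ_of_le (Finset.le_sup hm)⟩
  obtain ⟨x, hx, hx0, hb⟩ := Nat.find_spec hex
  have hkill : ∀ k : ℕ, vir μ ((k : ℤ) + 1) x = 0 := by
    intro k
    by_contra hne
    have hlt : Nat.find hex - (k + 1) < Nat.find hex := by
      obtain ⟨m, hm⟩ := support_nonempty.2 hx0
      have := hb m hm
      omega
    refine Nat.find_min hex hlt ⟨_, hN _ x hx, hne, fun m' hm' => ?_⟩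
    obtain ⟨m, hm, hmm⟩ := exists_of_coeff_vir_ne_zero (mem_support_iff.1 hm')
    have := hb m hm
    omega
  obtain ⟨K, hK⟩ := exists_mem_supported_range x
  have hK2 := supported_range_mono (show K ≤ 2 * K by omega) hK
  have h1 := sum_X_mul_vir (μ := μ) le_rfl hK
  simp only [hkill, mul_zero, Finset.sum_const_zero] at h1
  have h2 : grade (2 * K) x = 0 := by
    refine grade_eq_zero_of_join_cut one_ne_zero hμ hK2 ?_
    rw [inv_one, one_smul, one_smul]
    exact h1.symm
  rw [← der_zero_eq_grade hK2] at h2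
  have h3 := eq_C_of_der_zero h2
  have hc : constantCoeff x ≠ 0 := by
    intro hc
    rw [hc, map_zero] at h3
    exact hx0 h3
  have h4 : (1 : Fock) = (constantCoeff x)⁻¹ • x := by
    conv_rhs => rw [h3]
    rw [smul_eq_C_mul, ← C_mul, constantCoeff_C, inv_mul_cancel₀ hc, C_1]
  rw [h4]
  exact N.smul_mem _ hx

/-- The vacuum generates the Fock space under the Virasoro modes. -/
lemma eq_top_of_vir_invariant (hμ : ∀ a b : ℤ, (a : ℂ) = b * μ → b = 0) {G : Submodule ℂ Fock}
    (hG : ∀ n : ℤ, ∀ x ∈ G, vir μ n x ∈ G) (h1 : (1 : Fock) ∈ G) : G = ⊤ := by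
  have hlev : ∀ n : ℕ, level n ≤ G := by
    intro n
    induction n using Nat.strong_induction_on with
    | _ n ih =>
      rcases Nat.eq_zero_or_pos n with rfl | hn
      · intro f hf
        rw [mem_level_iff, Nat.cast_zero, zero_smul] at hf
        rw [eq_C_of_der_zero hf, ← mul_one (C _), ← smul_eq_C_mul]
        exact G.smul_mem _ h1
      · set R : Fock →ₗ[ℂ] Fock :=
          ∑ k ∈ Finset.range n, vir μ (-((k : ℤ) + 1)) * (ann k).toLinearMap with hR
        have hRa : ∀ f, R f = ∑ k ∈ Finset.range n, vir μ (-((k : ℤ) + 1)) (ann k f) := by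
          intro f
          simp only [hR, LinearMap.sum_apply, Module.End.mul_apply, derivation_toLinearMap_apply]
        have hmaps : ∀ f ∈ level n, R f ∈ level n := by
          intro f hf
          rw [hRa]
          refine Submodule.sum_mem _ fun k hk => ?_
          have := Finset.mem_range.1 hk
          exact vir_mem_level (n := n - (k + 1)) (by omega)
            (ann_mem_level (by omega) hf)
        have hinj : Function.Injective (R.restrict hmaps) := by
          rw [injective_iff_map_eq_zero]
          rintro ⟨f, hf⟩ h
          have h2 : R f = 0 := congrArg Subtype.val h
          have hs := level_le_supported hf
          have h3 := sum_vir_ann (μ := μ) hs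
          rw [← hRa, h2, smul_zero] at h3
          have h4 := grade_eq_zero_of_join_cut two_ne_zero hμ hs h3.symm
          rw [← der_zero_eq_grade hs, mem_level_iff.1 hf] at h4
          have h5 : f = 0 := (smul_eq_zero.1 h4).resolve_left (by exact_mod_cast hn.ne')
          exact Subtype.ext h5
        have hsurj := LinearMap.injective_iff_surjective.1 hinj
        intro f hf
        obtain ⟨⟨g, hg⟩, hgf⟩ := hsurj ⟨f, hf⟩
        have h2 : R g = f := congrArg Subtype.val hgf
        rw [← h2, hRa]
        refine Submodule.sum_mem _ fun k hk => hG _ _ ?_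
        have := Finset.mem_range.1 hk
        exact ih (n - (k + 1)) (by omega) (ann_mem_level (by omega) hg)
  rw [eq_top_iff]
  intro f _
  induction f using MvPolynomial.induction_on' with
  | monomial m a => exact hlev _ (monomial_mem_level m a)
  | add p q hp hq => exact add_mem (hp trivial) (hq trivial)

lemma sum_toMultiset (m : ℕ →₀ ℕ) : ((Finsupp.toMultiset m).map (· + 1)).sum = lvl m := by
  induction m using Finsupp.induction_linear with
  | zero => simp
  | add m₁ m₂ h₁ h₂ => rw [map_add, Multiset.map_add, Multiset.sum_add, h₁, h₂, map_add]
  | single i k =>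
    rw [Finsupp.toMultiset_single, Finsupp.weight_single, Multiset.map_nsmul, Multiset.sum_nsmul]
    simp

lemma word_mem_level (l : List ℕ) : word (vir μ) 1 l ∈ level ((l.map (· + 1)).sum) := by
  induction l with
  | nil =>
    simp only [word_nil, List.map_nil, List.sum_nil]
    rw [mem_level_iff, Derivation.map_one_eq_zero, Nat.cast_zero, zero_smul]
  | cons k l ih =>
    rw [word_cons]
    refine vir_mem_level ?_ ih
    simp only [List.map_cons, List.sum_cons]
    push_cast
    ring

lemma wordMap_vir_mem_level {n : ℕ} {f : Fock} (hf : f ∈ level n) :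
    wordMap (vir μ) 1 f ∈ level n := by
  rw [← support_sum_monomial_coeff f, map_sum]
  refine Submodule.sum_mem _ fun m hm => ?_
  rw [← mul_one (coeff m f), ← smul_eq_mul, ← smul_monomial, map_smul, wordMap_monomial]
  refine Submodule.smul_mem _ _ ?_
  have h1 := word_mem_level (μ := μ) (Finsupp.toMultiset m).toList
  rwa [← Multiset.sum_coe, ← Multiset.map_coe, Multiset.coe_toList, sum_toMultiset,
    show lvl m = n from hf (mem_support_iff.1 hm)] at h1

lemma wordMap_vir_injective (hμ : ∀ a b : ℤ, (a : ℂ) = b * μ → b = 0) :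
    Function.Injective (wordMap (vir μ) 1) := by
  have hL := relations_vir (μ := μ)
  have hv := highestWeight_vir (μ := μ)
  have htop : LinearMap.range (wordMap (vir μ) 1) = ⊤ :=
    eq_top_of_vir_invariant hμ (fun n x hx => map_mem_range_wordMap hL hv n hx)
      (self_mem_range_wordMap hL)
  have hcomp : ∀ (n : ℕ) (f : Fock),
      weightedHomogeneousComponent (fun i => i + 1) n (wordMap (vir μ) 1 f) =
        wordMap (vir μ) 1 (weightedHomogeneousComponent (fun i => i + 1) n f) := by
    intro n f
    induction f using MvPolynomial.induction_on' with
    | monomial m a =>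
      rw [weightedHomogeneousComponent_of_mem (monomial_mem_level m a),
        weightedHomogeneousComponent_of_mem (wordMap_vir_mem_level (monomial_mem_level m a))]
      split_ifs
      · rfl
      · rw [map_zero]
    | add p q hp hq => rw [map_add, map_add, hp, hq, map_add, map_add]
  have hlev : ∀ n : ℕ, ∀ f ∈ level n, wordMap (vir μ) 1 f = 0 → f = 0 := by
    intro n
    have hmaps : ∀ f ∈ level n, wordMap (vir μ) 1 f ∈ level n :=
      fun f hf => wordMap_vir_mem_level hf
    have hsurj : Function.Surjective ((wordMap (vir μ) 1).restrict hmaps) := by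
      rintro ⟨g, hg⟩
      obtain ⟨f, hf⟩ : g ∈ LinearMap.range (wordMap (vir μ) 1) := htop ▸ trivial
      refine ⟨⟨weightedHomogeneousComponent (fun i => i + 1) n f,
        weightedHomogeneousComponent_mem _ _ _⟩, Subtype.ext ?_⟩
      change wordMap (vir μ) 1 (weightedHomogeneousComponent (fun i => i + 1) n f) = g
      rw [← hcomp, hf, weightedHomogeneousComponent_of_mem hg, if_pos rfl]
    have hinj := LinearMap.injective_iff_surjective.2 hsurj
    intro f hf h
    have := (injective_iff_map_eq_zero _).1 hinj ⟨f, hf⟩ (Subtype.ext h)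
    exact congrArg Subtype.val this
  rw [injective_iff_map_eq_zero]
  intro f hf
  rw [← sum_weightedHomogeneousComponent (fun i => i + 1) f]
  refine finsum_eq_zero_of_forall_eq_zero fun n => ?_
  refine hlev n _ (weightedHomogeneousComponent_mem _ _ _) ?_
  rw [← hcomp, hf, map_zero]

lemma eq_zero_of_sq_eq (a b : ℤ) (h : (a : ℂ) ^ 2 = 24 * (b : ℂ) ^ 2) : b = 0 := by
  have h1 : a ^ 2 = 24 * b ^ 2 := by exact_mod_cast h
  by_contra hb
  obtain ⟨c, rfl⟩ := (Int.pow_dvd_pow_iff two_ne_zero).1 (Dvd.intro_left 24 h1.symm)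
  have h2 : c ^ 2 = 24 := by
    have : b ^ 2 * c ^ 2 = b ^ 2 * 24 := by linear_combination h1
    exact mul_left_cancel₀ (pow_ne_zero 2 hb) this
  have h3 : c < 5 := by nlinarith
  have h4 : -5 < c := by nlinarith
  interval_cases c <;> omega

/-- Every Virasoro highest weight module of central charge `1` and highest weight `6` is
irreducible. -/
theorem irreducible_of_highestWeight_six {V : Type*} [AddCommGroup V] [Module ℂ V]
    {L : ℤ → V →ₗ[ℂ] V} {v : V} (hL : Relations L) (hv : HighestWeight L 6 v)
    {N : Submodule ℂ V} (hN : ∀ n : ℤ, ∀ x ∈ N, L n x ∈ N)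
    (hle : N ≤ LinearMap.range (wordMap L v)) : N = ⊥ ∨ v ∈ N := by
  obtain ⟨μ, hμ2⟩ : ∃ μ : ℂ, μ ^ 2 = 24 := IsAlgClosed.exists_pow_nat_eq 24 two_pos
  have hμ : ∀ a b : ℤ, (a : ℂ) = b * μ → b = 0 := by
    intro a b h
    refine eq_zero_of_sq_eq a b ?_
    rw [h, mul_pow, hμ2, mul_comm]
  have hF := highestWeight_vir (μ := μ)
  rw [hμ2, show (24 : ℂ) / 4 = 6 by norm_num] at hF
  set P : ℤ → (V × Fock) →ₗ[ℂ] (V × Fock) := fun n => (L n).prodMap (vir μ n) with hPdef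
  have hP : Relations P := fun m n x => Prod.ext (hL m n x.1) (relations_vir m n x.2)
  have hPv : HighestWeight P 6 (v, 1) :=
    ⟨Prod.ext hv.1 hF.1, fun n hn => Prod.ext (hv.2 n hn) (hF.2 n hn)⟩
  have hword : ∀ l, word P (v, 1) l = (word L v l, word (vir μ) 1 l) := by
    intro l
    induction l with
    | nil => rfl
    | cons k l ih =>
      rw [word_cons, ih]
      rfl
  have hmap : ∀ f, wordMap P (v, 1) f = (wordMap L v f, wordMap (vir μ) 1 f) := by
    intro f
    have : wordMap P (v, 1) = (wordMap L v).prod (wordMap (vir μ) 1) := by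
      refine (MvPolynomial.basisMonomials ℕ ℂ).ext fun m => ?_
      rw [coe_basisMonomials, wordMap_monomial, hword, LinearMap.prod_apply]
      exact (Prod.ext (wordMap_monomial L v m) (wordMap_monomial (vir μ) 1 m)).symm
    rw [this]
    rfl
  have hstep : ∀ (n : ℤ) (f : Fock), ∃ g, wordMap L v g = L n (wordMap L v f) ∧
      wordMap (vir μ) 1 g = vir μ n (wordMap (vir μ) 1 f) := by
    intro n f
    obtain ⟨g, hg⟩ := map_mem_range_wordMap hP hPv n ⟨f, rfl⟩
    rw [hmap, hmap] at hg
    exact ⟨g, congrArg Prod.fst hg, congrArg Prod.snd hg⟩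
  have hstart : ∃ g, wordMap L v g = v ∧ wordMap (vir μ) 1 g = 1 := by
    obtain ⟨g, hg⟩ := self_mem_range_wordMap (v := (v, (1 : Fock))) hP
    rw [hmap] at hg
    exact ⟨g, congrArg Prod.fst hg, congrArg Prod.snd hg⟩
  have hinj := wordMap_vir_injective hμ
  by_cases h0 : (N.comap (wordMap L v)).map (wordMap (vir μ) 1) = ⊥
  · left
    rw [eq_bot_iff]
    intro x hx
    obtain ⟨f, rfl⟩ := hle hx
    have h1 : wordMap (vir μ) 1 f ∈ (N.comap (wordMap L v)).map (wordMap (vir μ) 1) :=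
      ⟨f, hx, rfl⟩
    rw [h0, Submodule.mem_bot] at h1
    rw [(injective_iff_map_eq_zero _).1 hinj f h1, map_zero]
    exact zero_mem _
  · right
    obtain ⟨f, hf, hf1⟩ := mem_of_vir_invariant hμ (by
      rintro n _ ⟨f, hf, rfl⟩
      obtain ⟨g, hg1, hg2⟩ := hstep n f
      refine ⟨g, ?_, hg2⟩
      change wordMap L v g ∈ N
      rw [hg1]
      exact hN n _ hf) h0
    obtain ⟨g, hg1, hg2⟩ := hstart
    have : f = g := hinj (hf1.trans hg2.symm)
    rw [← hg1, ← this]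
    exact hf

end Virasoro

namespace W3Rep

open Virasoro

variable (M : W3Rep 1)

lemma relations : Relations M.L := M.relLL

lemma highestWeight_one : HighestWeight M.L 0 M.one :=
  ⟨by rw [zero_smul, M.L_one 0 (by norm_num)], fun n hn => M.L_one n (by omega)⟩

lemma L_swap {m n : ℤ} (_ : n < m) (v : M.carrier) :
    M.L m (M.L n v) = M.L n (M.L m v) + ((m - n : ℤ) : ℂ) • M.L (m + n) v
      + (if m + n = 0 then ((m ^ 3 - m : ℤ) : ℂ) / 12 * 1 else 0) • v := by
  have h := M.relLL m n v
  linear_combination (norm := module) h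

lemma L_W (m n : ℤ) (v : M.carrier) :
    M.L m (M.W n v) = M.W n (M.L m v) + ((2 * m - n : ℤ) : ℂ) • M.W (m + n) v := by
  have h := M.relLW m n v
  linear_combination (norm := module) h

lemma W_L (m n : ℤ) (v : M.carrier) :
    M.W n (M.L m v) = M.L m (M.W n v) - ((2 * m - n : ℤ) : ℂ) • M.W (m + n) v := by
  have h := M.relLW m n v
  linear_combination (norm := module) -h

lemma W_swap (m n : ℤ) (v : M.carrier) (K : ℕ)
    (h₁ : ∀ j : ℕ, K ≤ j → M.L (m + n + ((j : ℤ) + 2)) v = 0)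
    (h₂ : ∀ j : ℕ, K ≤ j → M.L ((j : ℤ) - 1) v = 0) :
    M.W m (M.W n v) = M.W n (M.W m v) + (((m - n : ℤ) : ℂ) *
            ((1 / 15 : ℂ) * (((m + n + 2) * (m + n + 3) : ℤ) : ℂ)
              - (1 / 6 : ℂ) * (((m + 2) * (n + 2) : ℤ) : ℂ))) • M.L (m + n) v
        + ((16 / 27) * ((m - n : ℤ) : ℂ)) •
            ((∑ j ∈ Finset.range K, M.L (-((j : ℤ) + 2)) (M.L (m + n + ((j : ℤ) + 2)) v))
              + (∑ j ∈ Finset.range K, M.L (m + n - ((j : ℤ) - 1)) (M.L ((j : ℤ) - 1) v))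
              - ((3 / 10 : ℂ) * (((m + n + 2) * (m + n + 3) : ℤ) : ℂ)) • M.L (m + n) v)
        + (if m + n = 0 then ((m * (m ^ 2 - 1) * (m ^ 2 - 4) : ℤ) : ℂ) / 360 * 1 else 0) • v := by
  obtain ⟨N, hN⟩ := M.relWW m n v
  have h := hN (max N K) (le_max_left _ _)
  have hsub : Finset.range K ⊆ Finset.range (max N K) := Finset.range_mono (le_max_right _ _)
  rw [← Finset.sum_subset hsub, ← Finset.sum_subset hsub,
    show (16 : ℂ) / (22 + 5 * 1) = 16 / 27 by norm_num] at h
  · linear_combination (norm := module) h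
  · intro j _ hj
    rw [h₂ j (by simpa using hj), map_zero]
  · intro j _ hj
    rw [h₁ j (by simpa using hj), map_zero]

lemma L_w {n : ℤ} (hn : 1 ≤ n) : M.L n M.w = 0 := by
  rw [w, L_W, M.L_one n (by omega), map_zero, M.W_one _ (by omega), smul_zero, add_zero]

lemma L_zero_w : M.L 0 M.w = (3 : ℂ) • M.w := by
  rw [w, L_W, M.L_one 0 (by omega), map_zero, zero_add]
  norm_num

lemma W_three_w : M.W 3 M.w = (1 / 3 : ℂ) • M.one := by
  rw [w, W_swap M 3 (-3) M.one 0 (fun j _ => M.L_one _ (by omega)) fun j _ => M.L_one _ (by omega)]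
  rw [M.W_one 3 (by omega), M.L_one _ (by omega)]
  norm_num

lemma W_three_W_w : M.W 3 (M.W (-3) M.w) = (57 : ℂ) • M.w := by
  rw [W_swap M 3 (-3) M.w 2 (fun j _ => M.L_w (by omega)) fun j _ => M.L_w (by omega), W_three_w,
    map_smul, ← w]
  norm_num [Finset.sum_range_succ, L_w, L_zero_w, L_swap]
  module

lemma L_one_W_w : M.L 1 (M.W (-3) M.w) =
    (-10 / 27 : ℂ) • M.L (-5) M.one + (160 / 27 : ℂ) • M.L (-3) (M.L (-2) M.one) := by
  rw [L_W, L_w M le_rfl, w]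
  norm_num
  rw [W_swap M (-2) (-3) M.one 4 (fun j _ => M.L_one _ (by omega)) fun j _ => M.L_one _ (by omega)]
  norm_num [Finset.sum_range_succ, L_swap, M.L_one, M.W_one]
  module

lemma L_two_W_w : M.L 2 (M.W (-3) M.w) =
    (-7 / 9 : ℂ) • M.L (-4) M.one + (224 / 27 : ℂ) • M.L (-2) (M.L (-2) M.one) := by
  rw [L_W, L_w M (by norm_num), w]
  norm_num
  rw [W_swap M (-1) (-3) M.one 4 (fun j _ => M.L_one _ (by omega)) fun j _ => M.L_one _ (by omega)]
  norm_num [Finset.sum_range_succ, L_swap, M.L_one, M.W_one]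
  module

lemma L_zero_W_w : M.L 0 (M.W (-3) M.w) = (6 : ℂ) • M.W (-3) M.w := by
  rw [L_W, L_zero_w]
  norm_num
  module

/-- The general Virasoro descendant of weight `6` of the vacuum. -/
noncomputable def desc (a b c d : ℂ) : M.carrier :=
  a • M.L (-6) M.one + b • M.L (-4) (M.L (-2) M.one) + c • M.L (-3) (M.L (-3) M.one)
    + d • M.L (-2) (M.L (-2) (M.L (-2) M.one))

variable (a b c d : ℂ)

lemma L_zero_desc : M.L 0 (M.desc a b c d) = (6 : ℂ) • M.desc a b c d := by
  rw [desc]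
  norm_num [L_swap, M.L_one]
  module

lemma L_one_desc : M.L 1 (M.desc a b c d) =
    (7 * a + 4 * c + 6 * d) • M.L (-5) M.one
      + (5 * b + 8 * c + 9 * d) • M.L (-3) (M.L (-2) M.one) := by
  rw [desc]
  norm_num [L_swap, M.L_one]
  module

lemma L_two_desc : M.L 2 (M.desc a b c d) =
    (8 * a + (1 / 2) * b + 10 * c) • M.L (-4) M.one
      + (6 * b + (51 / 2) * d) • M.L (-2) (M.L (-2) M.one) := by
  rw [desc]
  norm_num [L_swap, M.L_one]
  module

lemma W_three_desc : M.W 3 (M.desc a b c d) = (15 * a + 33 * b + 54 * c + 105 * d) • M.w := by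
  rw [desc]
  norm_num [W_L, M.L_one, M.W_one, w]
  module

lemma L_six_desc : M.L 6 (M.desc a b c d) =
    ((35 / 2) * a + 5 * b + 18 * c + 24 * d) • M.one := by
  rw [desc]
  norm_num [L_swap, M.L_one]
  module

lemma L_two_L_four_desc : M.L 2 (M.L 4 (M.desc a b c d)) =
    (5 * a + (21 / 2) * b + 14 * c + (57 / 2) * d) • M.one := by
  rw [desc]
  norm_num [L_swap, M.L_one]
  module

lemma L_three_L_three_desc : M.L 3 (M.L 3 (M.desc a b c d)) =
    (18 * a + 14 * b + 44 * c + 30 * d) • M.one := by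
  rw [desc]
  norm_num [L_swap, M.L_one]
  module

lemma L_two_L_two_L_two_desc : M.L 2 (M.L 2 (M.L 2 (M.desc a b c d))) =
    (24 * a + (57 / 2) * b + 30 * c + (459 / 4) * d) • M.one := by
  rw [desc]
  norm_num [L_swap, M.L_one]
  module

/-- The primary vector of weight `6`. -/
noncomputable def u6 : M.carrier :=
  M.W (-3) M.w + M.desc (644 / 675) (676 / 675) (-331 / 450) (-1136 / 2025)

lemma highestWeight_u6 : HighestWeight M.L 6 M.u6 := by
  have h1 : M.L 1 M.u6 = 0 := by
    rw [u6, map_add, L_one_W_w, L_one_desc]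
    module
  have h2 : M.L 2 M.u6 = 0 := by
    rw [u6, map_add, L_two_W_w, L_two_desc]
    module
  refine ⟨?_, fun n hn => ?_⟩
  · rw [u6, map_add, L_zero_W_w, L_zero_desc, smul_add]
  · rcases hn.eq_or_lt with rfl | hn
    · exact h1
    · replace hn : 2 ≤ n := hn
      induction n, hn using Int.leInduction with
      | base => exact h2
      | succ n hn ih =>
        have hn' : M.L n M.u6 = 0 := ih (by omega)
        have h := M.relLL n 1 M.u6
        rw [h1, hn', map_zero, map_zero, sub_zero, if_neg (by omega), zero_smul, add_zero] at h
        refine (smul_eq_zero.1 h.symm).resolve_left ?_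
        have : n - 1 ≠ 0 := by omega
        exact_mod_cast this

lemma u6_ne_zero (h1 : M.one ≠ 0) : M.u6 ≠ 0 := by
  intro h
  have h2 : M.W 3 (M.W 3 M.u6) = 0 := by rw [h, map_zero, map_zero]
  rw [u6, map_add, W_three_W_w, W_three_desc, ← add_smul, map_smul, W_three_w, smul_smul,
    smul_eq_zero] at h2
  refine h2.elim (fun h3 => ?_) h1
  norm_num at h3

lemma virGen_eq_range {h : ℂ} {v : M.carrier} (hv : HighestWeight M.L h v) :
    M.VirGen v = LinearMap.range (wordMap M.L v) := by
  apply le_antisymm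
  · exact sInf_le ⟨self_mem_range_wordMap M.relations,
      fun n x hx => map_mem_range_wordMap M.relations hv n hx⟩
  · rw [← span_word_eq_range M.relations, Submodule.span_le]
    rintro _ ⟨l, rfl⟩
    exact Submodule.mem_sInf.2 fun N hN => word_mem N hN.2 hN.1 l

lemma virInvariant_virGen (v : M.carrier) : M.VirInvariant (M.VirGen v) :=
  fun n _ hx => Submodule.mem_sInf.2 fun N hN => hN.2 n _ (Submodule.mem_sInf.1 hx N hN)

lemma virGen_u6_irreducible {N : Submodule ℂ M.carrier} (hle : N ≤ M.VirGen M.u6)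
    (hN : M.VirInvariant N) : N = ⊥ ∨ N = M.VirGen M.u6 := by
  have hu := M.highestWeight_u6
  rcases irreducible_of_highestWeight_six M.relations hu hN
    (hle.trans (M.virGen_eq_range hu).le) with h | h
  · exact Or.inl h
  · exact Or.inr (le_antisymm hle (sInf_le ⟨h, hN⟩))

/-- The words spanning the weight spaces of weight at most `6` of the Virasoro vacuum module. -/
def basisWords : ℕ → Set M.carrier
  | 0 => {M.one}
  | 2 => {M.L (-2) M.one}
  | 3 => {M.L (-3) M.one}
  | 4 => {M.L (-4) M.one, M.L (-2) (M.L (-2) M.one)}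
  | 5 => {M.L (-5) M.one, M.L (-3) (M.L (-2) M.one)}
  | 6 => {M.L (-6) M.one, M.L (-4) (M.L (-2) M.one), M.L (-3) (M.L (-3) M.one),
      M.L (-2) (M.L (-2) (M.L (-2) M.one))}
  | _ => ∅

lemma map_basisWords_mem {k n : ℕ} (h : k + 1 + n ≤ 6) {x : M.carrier} (hx : x ∈ M.basisWords n) :
    M.L (-((k : ℤ) + 1)) x ∈ Submodule.span ℂ (M.basisWords (k + 1 + n)) := by
  have hn : n ≤ 5 := by omega
  have hk : k ≤ 5 := by omega
  interval_cases n <;> simp only [basisWords, Set.mem_singleton_iff, Set.mem_insert_iff,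
    Set.mem_empty_iff_false] at hx
  all_goals first | subst hx | rcases hx with rfl | rfl
  all_goals interval_cases k <;> first | omega | norm_num [L_swap, M.L_one]
  all_goals
    repeat' first
      | apply add_mem
      | apply Submodule.smul_mem
      | exact Submodule.subset_span (by simp [basisWords])

lemma word_mem_span_basisWords (l : List ℕ) (hl : (l.map (· + 1)).sum ≤ 6) :
    word M.L M.one l ∈ Submodule.span ℂ (M.basisWords (l.map (· + 1)).sum) := by
  induction l with
  | nil => exact Submodule.subset_span rfl
  | cons k l ih =>
    rw [List.map_cons, List.sum_cons] at hl ⊢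
    have h := ih (by omega)
    rw [word_cons]
    generalize word M.L M.one l = y at h
    induction h using Submodule.span_induction with
    | mem x hx => exact M.map_basisWords_mem hl hx
    | zero => rw [map_zero]; exact zero_mem _
    | add x y _ _ hx hy => rw [map_add]; exact add_mem hx hy
    | smul a x _ hx => rw [map_smul]; exact Submodule.smul_mem _ _ hx

lemma L_zero_word (l : List ℕ) : M.L 0 (word M.L M.one l) =
    (((l.map (· + 1)).sum : ℕ) : ℂ) • word M.L M.one l := by
  induction l with
  | nil => rw [word_nil, M.L_one 0 (by norm_num)]; simp
  | cons k l ih =>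
    rw [word_cons, L_swap _ (by omega), ih, if_neg (by omega), map_smul, zero_add, List.map_cons,
      List.sum_cons]
    push_cast
    module

lemma exists_eq_desc_of_mem_virGen {x : M.carrier} (hx : x ∈ M.VirGen M.one)
    (h6 : M.L 0 x = (6 : ℂ) • x) : ∃ a b c d, x = M.desc a b c d := by
  have hle : M.VirGen M.one ≤
      Submodule.span ℂ (M.basisWords 6) ⊔ ⨆ (r : ℂ) (_ : r ≠ 6), Module.End.eigenspace (M.L 0) r := by
    rw [M.virGen_eq_range M.highestWeight_one, ← span_word_eq_range M.relations,
      Submodule.span_le]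
    rintro _ ⟨l, rfl⟩
    by_cases hl : (l.map (· + 1)).sum = 6
    · refine Submodule.mem_sup_left ?_
      rw [← hl]
      exact M.word_mem_span_basisWords l hl.le
    · refine Submodule.mem_sup_right (Submodule.mem_iSup_of_mem _ (Submodule.mem_iSup_of_mem ?_
        (Module.End.mem_eigenspace_iff.2 (M.L_zero_word l))))
      exact_mod_cast hl
  obtain ⟨z, hz, y, hy, rfl⟩ := Submodule.mem_sup.1 (hle hx)
  obtain ⟨a, b, c, d, rfl⟩ : ∃ a b c d, z = M.desc a b c d := by
    simp only [basisWords, Submodule.mem_span_insert, Submodule.mem_span_singleton] at hz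
    obtain ⟨a, _, ⟨b, _, ⟨c, _, ⟨d, rfl⟩, rfl⟩, rfl⟩, rfl⟩ := hz
    exact ⟨a, b, c, d, by rw [desc]; module⟩
  refine ⟨a, b, c, d, ?_⟩
  have hy6 : M.L 0 y = (6 : ℂ) • y := by
    rw [map_add, L_zero_desc, smul_add] at h6
    exact add_left_cancel h6
  have hy0 := (Submodule.disjoint_def.1 (Module.End.eigenspaces_iSupIndep (M.L 0) 6)) y
    (Module.End.mem_eigenspace_iff.2 hy6) hy
  rw [hy0, add_zero]

lemma u6_not_mem (h1 : M.one ≠ 0) : M.u6 ∉ M.VirGen M.one := by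
  intro hu
  have hw := M.highestWeight_u6
  obtain ⟨a, b, c, d, h⟩ := M.exists_eq_desc_of_mem_virGen hu hw.1
  have hz : ∀ n : ℤ, 1 ≤ n → M.L n (M.desc a b c d) = 0 := h ▸ hw.2
  have e1 := M.L_six_desc a b c d
  have e2 := M.L_two_L_four_desc a b c d
  have e3 := M.L_three_L_three_desc a b c d
  have e4 := M.L_two_L_two_L_two_desc a b c d
  rw [hz _ (by norm_num), eq_comm, smul_eq_zero, or_iff_left h1] at e1
  rw [hz _ (by norm_num), map_zero, eq_comm, smul_eq_zero, or_iff_left h1] at e2 e3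
  rw [hz _ (by norm_num), map_zero, map_zero, eq_comm, smul_eq_zero, or_iff_left h1] at e4
  have ha : a = 0 := by
    linear_combination (458 * e1 + 632 * e2 - 263 * e3 - 184 * e4) / 2025
  have hb : b = 0 := by
    linear_combination (632 * e1 + 1778 * e2 - 527 * e3 - 436 * e4) / 2025
  have hc : c = 0 := by
    linear_combination (-263 * e1 - 527 * e2 + 947 / 4 * e3 + 124 * e4) / 2025
  have hd : d = 0 := by
    linear_combination (-184 * e1 - 436 * e2 + 124 * e3 + 132 * e4) / 2025
  refine M.u6_ne_zero h1 ?_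
  rw [h, ha, hb, hc, hd, desc]
  simp

lemma virGen_inf_virGen_u6 (h1 : M.one ≠ 0) : M.VirGen M.one ⊓ M.VirGen M.u6 = ⊥ := by
  refine (M.virGen_u6_irreducible inf_le_right fun n x hx =>
    ⟨M.virInvariant_virGen _ n x hx.1, M.virInvariant_virGen _ n x hx.2⟩).resolve_right ?_
  intro h
  refine M.u6_not_mem h1 ?_
  have := M.mem_VirGen_self M.u6
  rw [← h] at this
  exact this.1

lemma desc_mem_virGen (a b c d : ℂ) : M.desc a b c d ∈ M.VirGen M.one := by
  have h0 := M.mem_VirGen_self M.one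
  have hL := fun (n : ℤ) {x : M.carrier} hx => M.virInvariant_virGen M.one n x hx
  exact add_mem (add_mem (add_mem (Submodule.smul_mem _ _ (hL _ h0))
    (Submodule.smul_mem _ _ (hL _ (hL _ h0)))) (Submodule.smul_mem _ _ (hL _ (hL _ h0))))
    (Submodule.smul_mem _ _ (hL _ (hL _ (hL _ h0))))

end W3Rep

/-- In `M̄(1,0,0)` there is a nonzero primary vector `u⁽⁶⁾`
of weight `6` of the form `u⁽⁶⁾ = a₁ W₋₃w + v` with `a₁ ≠ 0` and `v` in the
Virasoro vacuum submodule `L(1,0)` generated by `𝟙`; consequently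
`W₋₃w ∈ L(1,0) ⊕ L(1,6)` where `L(1,6)` is the `L(1,0)`-submodule generated
by `u⁽⁶⁾`, an irreducible highest weight module for the Virasoro algebra of
highest weight `6`. -/
theorem W3_vacuum_weight_six_primary (M : W3Vacuum 1) :
    ∃ (u6 : M.carrier) (a1 : ℂ) (v : M.carrier),
      a1 ≠ 0 ∧
      v ∈ M.toW3Rep.VirGen M.one ∧
      u6 = a1 • M.toW3Rep.W (-3) M.toW3Rep.w + v ∧
      M.toW3Rep.IsPrimary u6 ∧
      u6 ∈ M.toW3Rep.wt 6 ∧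
      M.toW3Rep.W (-3) M.toW3Rep.w
        ∈ M.toW3Rep.VirGen M.one ⊔ M.toW3Rep.VirGen u6 ∧
      (M.toW3Rep.VirGen M.one ⊓ M.toW3Rep.VirGen u6 = ⊥) ∧
      (M.toW3Rep.VirGen u6 ≠ ⊥ ∧
        ∀ N : Submodule ℂ M.carrier, N ≤ M.toW3Rep.VirGen u6 →
          M.toW3Rep.VirInvariant N → N = ⊥ ∨ N = M.toW3Rep.VirGen u6) := by
  have hu := M.toW3Rep.highestWeight_u6
  have hne := M.toW3Rep.u6_ne_zero M.one_ne
  have hv := M.toW3Rep.desc_mem_virGen (644 / 675) (676 / 675) (-331 / 450) (-1136 / 2025)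
  have hu_mem := M.toW3Rep.mem_VirGen_self M.toW3Rep.u6
  refine ⟨M.toW3Rep.u6, 1, _, one_ne_zero, hv, by rw [one_smul]; rfl, ⟨hne, hu.2⟩, ?_, ?_,
    M.toW3Rep.virGen_inf_virGen_u6 M.one_ne, ?_,
    fun N hle hN => M.toW3Rep.virGen_u6_irreducible hle hN⟩
  · rw [W3Rep.wt, LinearMap.mem_ker, LinearMap.sub_apply, hu.1, LinearMap.smul_apply,
      LinearMap.id_apply, sub_self]
  · have h := sub_mem (Submodule.mem_sup_right hu_mem) (Submodule.mem_sup_left hv)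
    rwa [W3Rep.u6, add_sub_cancel_right] at h
  · intro h
    rw [h, Submodule.mem_bot] at hu_mem
    exact hne hu_mem
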